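/- arXiv:2505.13849 — 4 statements merged into one kernel-verified Lean document; each statement's English description precedes it below -/
import Mathlib

section
/- Let Ω be a finite set and G ≤ Sym(Ω) a primitive permutation group with 2 ≤ b(G) ≤ 7. Suppose that for all distinct α, β ∈ Ω there exist a point γ ∉ {α, β} and edges E_α, E_β of the Saxl hypergraph Σ(G) with α, γ ∈ E_α and β, γ ∈ E_β. Then one of the following holds: (a) G = Sym(Ω) with |Ω| ≥ 4; (b) G = Alt(Ω) with |Ω| ≥ 6; or (c) for all distinct α, β ∈ Ω there exist edges E_α, E_β of Σ(G) with α ∈ E_α, β ∈ E_β and |E_α ∩ E_β| = 1. -/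
/-- `B` is a base for the permutation group `G ≤ Sym(Ω)`: its pointwise
stabiliser in `G` is trivial. -/
def IsBase {Ω : Type*} (G : Subgroup (Equiv.Perm Ω)) (B : Set Ω) : Prop :=
  ∀ g ∈ G, (∀ b ∈ B, g b = b) → g = 1

/-- The base size `b(G)`: the minimum cardinality of a base for `G`. -/
noncomputable def baseSize {Ω : Type*} (G : Subgroup (Equiv.Perm Ω)) : ℕ :=
  sInf {n | ∃ B : Set Ω, IsBase G B ∧ B.ncard = n}

/-- `E` is an edge of the Saxl hypergraph `Σ(G)`: a base for `G` of size
`b(G)`. -/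
def IsSaxlEdge {Ω : Type*} (G : Subgroup (Equiv.Perm Ω)) (E : Set Ω) : Prop :=
  IsBase G E ∧ E.ncard = baseSize G

/-- `G ≤ Sym(Ω)` is primitive: transitive, and every block is trivial or all
of `Ω`. -/
def IsPrimitivePerm {Ω : Type*} (G : Subgroup (Equiv.Perm Ω)) : Prop :=
  (∀ α β : Ω, ∃ g ∈ G, g α = β) ∧
  ∀ B : Set Ω, (∀ g ∈ G, ⇑g '' B = B ∨ Disjoint (⇑g '' B) B) →
    B.Subsingleton ∨ B = Set.univ


set_option linter.all false

namespace SaxlAux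

open Equiv

variable {Ω : Type*} [Fintype Ω] [DecidableEq Ω]

/-- pointwise stabiliser -/
def Fx (G : Subgroup (Perm Ω)) (S : Finset Ω) : Subgroup (Perm Ω) where
  carrier := {g | g ∈ G ∧ ∀ x ∈ S, g x = x}
  mul_mem' := by
    rintro a b ⟨ha, ha'⟩ ⟨hb, hb'⟩
    refine ⟨G.mul_mem ha hb, fun x hx => ?_⟩
    rw [Perm.mul_apply, hb' x hx, ha' x hx]
  one_mem' := ⟨G.one_mem, fun _ _ => rfl⟩
  inv_mem' := by
    rintro a ⟨ha, ha'⟩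
    refine ⟨G.inv_mem ha, fun x hx => ?_⟩
    rw [Perm.inv_eq_iff_eq, ha' x hx]

theorem mem_Fx {G : Subgroup (Perm Ω)} {S : Finset Ω} {g : Perm Ω} :
    g ∈ Fx G S ↔ g ∈ G ∧ ∀ x ∈ S, g x = x := Iff.rfl

/-- `x` is a regular point of `K`. -/
def Reg (K : Subgroup (Perm Ω)) (x : Ω) : Prop := ∀ h ∈ K, h x = x → h = 1

/-- finset version of edges -/
def Edge (G : Subgroup (Perm Ω)) (E : Finset Ω) : Prop := IsSaxlEdge G (E : Set Ω)

theorem Edge.base {G : Subgroup (Perm Ω)} {E : Finset Ω} (h : Edge G E) {g : Perm Ω}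
    (hg : g ∈ G) (hf : ∀ x ∈ E, g x = x) : g = 1 :=
  h.1 g hg (fun b hb => hf b (by simpa using hb))

theorem Edge.card {G : Subgroup (Perm Ω)} {E : Finset Ω} (h : Edge G E) :
    E.card = baseSize G := by
  have := h.2
  rwa [Set.ncard_coe_finset] at this

theorem base_card {G : Subgroup (Perm Ω)} {E : Finset Ω}
    (h : ∀ g ∈ G, (∀ x ∈ E, g x = x) → g = 1) : baseSize G ≤ E.card := by
  apply Nat.sInf_le
  refine ⟨(E : Set Ω), ?_, Set.ncard_coe_finset E⟩
  intro g hg hf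
  exact h g hg (fun x hx => hf x (by simpa using hx))

theorem edge_mk {G : Subgroup (Perm Ω)} {E : Finset Ω}
    (h : ∀ g ∈ G, (∀ x ∈ E, g x = x) → g = 1) (hc : E.card = baseSize G) : Edge G E := by
  refine ⟨fun g hg hf => h g hg (fun x hx => hf x (by simpa using hx)), ?_⟩
  rw [Set.ncard_coe_finset, hc]

theorem Edge.exists_move {G : Subgroup (Perm Ω)} {E : Finset Ω} (h : Edge G E) {e : Ω}
    (he : e ∈ E) : ∃ g ∈ Fx G (E.erase e), g ≠ 1 := by
  by_contra hcon
  push Not at hcon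
  have h1 : baseSize G ≤ (E.erase e).card := base_card (fun g hg hf => hcon g ⟨hg, hf⟩)
  have h2 := Finset.card_erase_lt_of_mem he
  rw [h.card] at h2
  omega

theorem Edge.reg {G : Subgroup (Perm Ω)} {E : Finset Ω} (h : Edge G E) {e : Ω} :
    Reg (Fx G (E.erase e)) e := by
  rintro g ⟨hg, hf⟩ hge
  refine h.base hg (fun x hx => ?_)
  by_cases hxe : x = e
  · rw [hxe, hge]
  · exact hf x (Finset.mem_erase.2 ⟨hxe, hx⟩)

theorem Edge.reg_notMem {G : Subgroup (Perm Ω)} {E : Finset Ω} (h : Edge G E) {e x : Ω}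
    (he : e ∈ E) (hx : Reg (Fx G (E.erase e)) x) : x ∉ E.erase e := by
  intro hxE
  obtain ⟨g, hg, hg1⟩ := h.exists_move he
  exact hg1 (hx g hg (hg.2 x hxE))

theorem Edge.exch {G : Subgroup (Perm Ω)} {E : Finset Ω} (h : Edge G E) {e x : Ω}
    (he : e ∈ E) (hx : Reg (Fx G (E.erase e)) x) : Edge G (insert x (E.erase e)) := by
  refine edge_mk (fun g hg hf => ?_) ?_
  · exact hx g ⟨hg, fun y hy => hf y (Finset.mem_insert_of_mem hy)⟩
      (hf x (Finset.mem_insert_self _ _))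
  · rw [Finset.card_insert_of_notMem (h.reg_notMem he hx), Finset.card_erase_of_mem he, ← h.card]
    have := Finset.card_pos.2 ⟨e, he⟩
    omega

/-- commutator of two permutations whose supports meet in one point -/
theorem comm_three {s t : Perm Ω} {e : Ω} (hs : s e ≠ e) (ht : t e ≠ e)
    (hst : ∀ x, x ≠ e → s x = x ∨ t x = x) :
    (s * t * s⁻¹ * t⁻¹).IsThreeCycle := by
  have h1 : t (s e) = s e := by
    rcases hst (s e) hs with h | h
    · exact absurd (s.injective h) hs
    · exact h
  have h2 : s (t e) = t e := by
    rcases hst (t e) ht with h | h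
    · exact h
    · exact absurd (t.injective h) ht
  have hne : s e ≠ t e := fun h => by rw [h] at h1; exact ht (t.injective h1)
  have key : s * t = swap e (t e) * swap e (s e) * (t * s) := by
    ext x
    simp only [Perm.mul_apply]
    by_cases hx : x = e
    · subst hx
      rw [h1, h2, swap_apply_right, swap_apply_left]
    · rcases hst x hx with h | h
      · rw [h]
        by_cases hq : t x = e
        · rw [hq, swap_apply_left, swap_apply_of_ne_of_ne hs hne]
        · have h3 : t x ≠ s e := fun h' => by
            rw [← h1] at h'
            have := t.injective h'
            rw [this] at h
            exact hs (s.injective h)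
          have h4 : t x ≠ t e := fun h' => hx (t.injective h')
          rw [swap_apply_of_ne_of_ne hq h3, swap_apply_of_ne_of_ne hq h4]
          rcases hst (t x) hq with h5 | h5
          · exact h5
          · have := t.injective h5
            rw [this, h]
      · rw [h]
        by_cases hq : s x = e
        · rw [hq, swap_apply_of_ne_of_ne ht hne.symm, swap_apply_right]
        · have h3 : s x ≠ t e := fun h' => by
            rw [← h2] at h'
            have := s.injective h'
            rw [this] at h
            exact ht (t.injective h)
          have h4 : s x ≠ s e := fun h' => hx (s.injective h')
          rcases hst (s x) hq with h5 | h5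
          · have := s.injective h5
            rw [this] at h3 h4 hq ⊢
            rw [h, swap_apply_of_ne_of_ne hq h4, swap_apply_of_ne_of_ne hq h3]
          · rw [h5, swap_apply_of_ne_of_ne hq h4, swap_apply_of_ne_of_ne hq h3]
  rw [key]
  have : swap e (t e) * swap e (s e) * (t * s) * s⁻¹ * t⁻¹ = swap e (t e) * swap e (s e) := by
    group
  rw [this]
  exact Perm.isThreeCycle_swap_mul_swap_same ht.symm hs.symm hne.symm

theorem preprim {G : Subgroup (Perm Ω)} (h : IsPrimitivePerm G) :
    MulAction.IsPreprimitive G Ω := by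
  have : MulAction.IsPretransitive G Ω := ⟨fun a b => by
    obtain ⟨g, hg, hgab⟩ := h.1 a b
    exact ⟨⟨g, hg⟩, hgab⟩⟩
  refine { isTrivialBlock_of_isBlock := fun {B} hB => ?_ }
  refine h.2 B (fun g hg => ?_)
  exact (MulAction.isBlock_iff_smul_eq_or_disjoint.1 hB) ⟨g, hg⟩

theorem top_or_alt {G : Subgroup (Perm Ω)} (h : alternatingGroup Ω ≤ G) :
    G = ⊤ ∨ G = alternatingGroup Ω := by
  by_cases hG : G ≤ alternatingGroup Ω
  · exact Or.inr (le_antisymm hG h)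
  · left
    obtain ⟨g, hg, hg'⟩ := SetLike.not_le_iff_exists.1 hG
    rw [Perm.mem_alternatingGroup] at hg'
    have hgs : Perm.sign g = -1 := (Int.units_eq_one_or _).resolve_left hg'
    rw [eq_top_iff]
    intro x _
    rcases Int.units_eq_one_or (Perm.sign x) with hx | hx
    · exact h (Perm.mem_alternatingGroup.2 hx)
    · have : x * g⁻¹ ∈ G := h (Perm.mem_alternatingGroup.2 (by simp [hx, hgs]))
      simpa using G.mul_mem this hg

/-- minimal pairs -/
structure MinPair (G : Subgroup (Perm Ω)) (m : ℕ) (α β : Ω) (E F : Finset Ω) : Prop where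
  eE : Edge G E
  eF : Edge G F
  hα : α ∈ E
  hβ : β ∈ F
  hm : (E ∩ F).card = m
  min : ∀ E' F' : Finset Ω, Edge G E' → Edge G F' → α ∈ E' → β ∈ F' →
    (E' ∩ F').card < m → E' ∩ F' = ∅

theorem MinPair.symm {G : Subgroup (Perm Ω)} {m : ℕ} {α β : Ω} {E F : Finset Ω}
    (h : MinPair G m α β E F) : MinPair G m β α F E where
  eE := h.eF
  eF := h.eE
  hα := h.hβ
  hβ := h.hα
  hm := by rw [Finset.inter_comm]; exact h.hm
  min := fun E' F' hE hF hb ha hc => by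
    rw [Finset.inter_comm] at hc ⊢
    exact h.min F' E' hF hE ha hb hc

theorem MinPair.exchF {G : Subgroup (Perm Ω)} {m : ℕ} (h2 : 2 ≤ m) {α β : Ω} {E F : Finset Ω}
    (h : MinPair G m α β E F) {e x : Ω} (he : e ∈ E ∩ F) (heb : e ≠ β)
    (hx : Reg (Fx G (F.erase e)) x) : x ∈ insert e (E \ F) := by
  obtain ⟨heE, heF⟩ := Finset.mem_inter.1 he
  have hxF := h.eF.reg_notMem heF hx
  have hex := h.eF.exch heF hx
  by_cases hxe : x = e
  · simp [hxe]
  by_cases hxE : x ∈ E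
  · refine Finset.mem_insert_of_mem (Finset.mem_sdiff.2 ⟨hxE, fun hh => hxF ?_⟩)
    exact Finset.mem_erase.2 ⟨hxe, hh⟩
  · exfalso
    have hI : E ∩ insert x (F.erase e) = (E ∩ F).erase e := by
      ext y
      simp only [Finset.mem_inter, Finset.mem_insert, Finset.mem_erase]
      constructor
      · rintro ⟨hy, rfl | ⟨h3, h4⟩⟩
        · exact absurd hy hxE
        · exact ⟨h3, hy, h4⟩
      · rintro ⟨h3, hy, h4⟩
        exact ⟨hy, Or.inr ⟨h3, h4⟩⟩
    have hc : ((E ∩ F).erase e).card = m - 1 := by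
      rw [Finset.card_erase_of_mem he, h.hm]
    have := h.min E _ h.eE hex h.hα
      (Finset.mem_insert_of_mem (Finset.mem_erase.2 ⟨heb.symm, h.hβ⟩)) (by rw [hI, hc]; omega)
    rw [hI] at this
    rw [this, Finset.card_empty] at hc
    omega

/-- exchanging a common point of `E` by another point of `F`. -/
theorem MinPair.moveE {G : Subgroup (Perm Ω)} {m : ℕ} (h2 : 2 ≤ m) {α β : Ω} {E F : Finset Ω}
    (h : MinPair G m α β E F) {e x : Ω} (he : e ∈ E ∩ F) (hea : e ≠ α)
    (hx : Reg (Fx G (E.erase e)) x) :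
    MinPair G m α β (insert x (E.erase e)) F ∧ insert x (E.erase e) \ F = E \ F ∧
      x ∈ F ∧ insert x (E.erase e) ∩ F = insert x ((E ∩ F).erase e) ∧ x ∉ (E ∩ F).erase e := by
  obtain ⟨heE, heF⟩ := Finset.mem_inter.1 he
  have hxm := h.symm.exchF h2 (by rwa [Finset.inter_comm]) hea hx
  have hxE := h.eE.reg_notMem heE hx
  have hxF : x ∈ F := by
    rcases Finset.mem_insert.1 hxm with rfl | h3
    · exact heF
    · exact (Finset.mem_sdiff.1 h3).1
  have hI : insert x (E.erase e) ∩ F = insert x ((E ∩ F).erase e) := by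
    ext y
    simp only [Finset.mem_inter, Finset.mem_insert, Finset.mem_erase]
    constructor
    · rintro ⟨rfl | ⟨h3, h4⟩, h5⟩
      · exact Or.inl rfl
      · exact Or.inr ⟨h3, h4, h5⟩
    · rintro (rfl | ⟨h3, h4, h5⟩)
      · exact ⟨Or.inl rfl, hxF⟩
      · exact ⟨Or.inr ⟨h3, h4⟩, h5⟩
  have hxI : x ∉ (E ∩ F).erase e := fun hh => hxE (by
    simp only [Finset.mem_erase, Finset.mem_inter] at hh ⊢
    exact ⟨hh.1, hh.2.1⟩)
  refine ⟨⟨h.eE.exch heE hx, h.eF,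
    Finset.mem_insert_of_mem (Finset.mem_erase.2 ⟨hea.symm, h.hα⟩), h.hβ, ?_, h.min⟩, ?_, hxF, hI,
    hxI⟩
  · rw [hI, Finset.card_insert_of_notMem hxI, Finset.card_erase_of_mem he, h.hm]
    omega
  · ext y
    simp only [Finset.mem_sdiff, Finset.mem_insert, Finset.mem_erase]
    constructor
    · rintro ⟨rfl | ⟨h3, h4⟩, h5⟩
      · exact absurd hxF h5
      · exact ⟨h4, h5⟩
    · rintro ⟨h4, h5⟩
      exact ⟨Or.inr ⟨fun h6 => h5 (h6 ▸ heF), h4⟩, h5⟩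

/-- the conclusion if some element has small support -/
theorem concl_of_small {G : Subgroup (Perm Ω)} (hprim : IsPrimitivePerm G) {m : ℕ} (h2 : 2 ≤ m)
    {α β : Ω} {E F : Finset Ω} (h : MinPair G m α β E F) {e : Ω} (he : e ∈ E ∩ F)
    {s : Perm Ω} (hs : s ∈ Fx G (F.erase e)) (hs1 : s ≠ 1)
    (hsupp : ∀ x, s x ≠ x → x ∈ insert e (E \ F)) :
    (G = ⊤ ∧ 4 ≤ Fintype.card Ω) ∨ (G = alternatingGroup Ω ∧ 6 ≤ Fintype.card Ω) := by
  obtain ⟨heE, heF⟩ := Finset.mem_inter.1 he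
  have hse : s e ≠ e := fun hh => hs1 (h.eF.reg s hs hh)
  obtain ⟨t, ht, ht1⟩ := h.eE.exists_move heE
  have hte : t e ≠ e := fun hh => ht1 (h.eE.reg t ht hh)
  have hst : ∀ x, x ≠ e → s x = x ∨ t x = x := by
    intro x hx
    by_cases hsx : s x = x
    · exact Or.inl hsx
    · right
      rcases Finset.mem_insert.1 (hsupp x hsx) with h3 | h3
      · exact absurd h3 hx
      · exact ht.2 x (Finset.mem_erase.2 ⟨hx, (Finset.mem_sdiff.1 h3).1⟩)
  have h3c := comm_three hse hte hst
  have hmem : s * t * s⁻¹ * t⁻¹ ∈ G :=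
    G.mul_mem (G.mul_mem (G.mul_mem hs.1 ht.1) (G.inv_mem hs.1)) (G.inv_mem ht.1)
  have halt := Perm.alternatingGroup_le_of_isPreprimitive_of_isThreeCycle_mem (preprim hprim)
    h3c hmem
  have hcard : m + 2 * (E \ F).card ≤ Fintype.card Ω := by
    have h1 := Finset.card_le_univ (E ∪ F)
    have h3 := Finset.card_union_add_card_inter E F
    have h4 := Finset.card_sdiff_add_card_inter E F
    have h5 := h.hm
    have h6 := h.eE.card
    have h7 := h.eF.card
    omega
  have hsub : s.support ⊆ insert e (E \ F) := fun x hx => hsupp x (Perm.mem_support.1 hx)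
  have hsc : s.support.card ≤ (E \ F).card + 1 :=
    (Finset.card_le_card hsub).trans (Finset.card_insert_le _ _)
  have hs2 : 2 ≤ s.support.card := Perm.two_le_card_support_of_ne_one hs1
  rcases top_or_alt halt with hG | hG
  · left
    exact ⟨hG, by omega⟩
  · right
    refine ⟨hG, ?_⟩
    have hs3 : s.support.card ≠ 2 := by
      intro hc
      have hsw := Perm.card_support_eq_two.1 hc
      have hsg : s ∈ alternatingGroup Ω := hG ▸ hs.1
      rw [Perm.mem_alternatingGroup, hsw.sign_eq] at hsg
      exact absurd hsg (by decide)
    omega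

theorem inv_ap (g : Perm Ω) (x : Ω) : g⁻¹ (g x) = x := by simp

theorem ap_inv (g : Perm Ω) (x : Ω) : g (g⁻¹ x) = x := by simp


open Classical in
/-- the orbit of `e` under `K`. -/
noncomputable def orb (K : Subgroup (Perm Ω)) (e : Ω) : Finset Ω :=
  Finset.univ.filter (fun x => ∃ g ∈ K, g e = x)

theorem mem_orb {K : Subgroup (Perm Ω)} {e x : Ω} : x ∈ orb K e ↔ ∃ g ∈ K, g e = x := by
  simp [orb]

theorem reg_smul {K : Subgroup (Perm Ω)} {e : Ω} (h : Reg K e) {g : Perm Ω} (hg : g ∈ K) :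
    Reg K (g e) := by
  intro k hk hke
  have h1 : g⁻¹ * k * g = 1 := by
    refine h _ (K.mul_mem (K.mul_mem (K.inv_mem hg) hk) hg) ?_
    rw [Perm.mul_apply, Perm.mul_apply, hke, inv_ap]
  have : k = g * (g⁻¹ * k * g) * g⁻¹ := by group
  rw [this, h1]; group

theorem orb_card {K : Subgroup (Perm Ω)} {e : Ω} (h : Reg K e) :
    (orb K e).card = Nat.card K := by
  classical
  rw [Nat.card_eq_fintype_card, ← Finset.card_univ]
  symm
  refine Finset.card_bij (fun g _ => (g : Perm Ω) e) ?_ ?_ ?_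
  · intro g _
    exact mem_orb.2 ⟨g, g.2, rfl⟩
  · intro g _ g' _ hgg
    have h1 : (g' : Perm Ω)⁻¹ * g = 1 := by
      refine h _ (K.mul_mem (K.inv_mem g'.2) g.2) ?_
      rw [Perm.mul_apply, hgg, inv_ap]
    exact Subtype.ext (inv_mul_eq_one.1 h1).symm
  · intro x hx
    obtain ⟨g, hg, rfl⟩ := mem_orb.1 hx
    exact ⟨⟨g, hg⟩, Finset.mem_univ _, rfl⟩

theorem self_mem_orb (K : Subgroup (Perm Ω)) (e : Ω) : e ∈ orb K e :=
  mem_orb.2 ⟨1, K.one_mem, rfl⟩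

theorem card_cases {K : Subgroup (Perm Ω)} {e : Ω} {X : Finset Ω} (he : Reg K e)
    (hX : ∀ x, Reg K x → x ∈ X) (hc : X.card ≤ 6) (hK : ∃ g ∈ K, g ≠ 1)
    (ns : ∀ s ∈ K, s ≠ 1 → ∃ x, s x ≠ x ∧ x ∉ X) :
    (Nat.card K = 4 ∧ ∀ g ∈ K, g * g = 1) ∨ Nat.card K = 6 := by
  obtain ⟨g, hg, hg1⟩ := hK
  have hle : Nat.card K ≤ 6 := by
    rw [← orb_card he]
    refine (Finset.card_le_card fun x hx => ?_).trans hc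
    obtain ⟨k, hk, rfl⟩ := mem_orb.1 hx
    exact hX _ (reg_smul he hk)
  have hnp : ¬ (Nat.card K).Prime := by
    intro hp
    obtain ⟨x, hx, hxX⟩ := ns g hg hg1
    refine hxX (hX x ?_)
    intro k hk hkx
    by_contra hk1
    haveI : Fact (Nat.card K).Prime := ⟨hp⟩
    have h1 : (⟨g, hg⟩ : K) ∈ Subgroup.zpowers (⟨k, hk⟩ : K) :=
      mem_zpowers_of_prime_card rfl (fun h => hk1 (congrArg Subtype.val h))
    obtain ⟨i, hi⟩ := Subgroup.mem_zpowers_iff.1 h1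
    have h2 : k ^ i = g := congrArg Subtype.val hi
    apply hx
    rw [← h2]
    exact Perm.zpow_apply_eq_self_of_apply_eq_self hkx i
  have h1 : Nat.card K ≠ 1 := by
    intro h1
    have := (Subgroup.card_eq_one.1 h1)
    rw [this] at hg
    exact hg1 (Subgroup.mem_bot.1 hg)
  have h0 : 0 < Nat.card K := Nat.card_pos
  have hc4 : Nat.card K = 4 ∨ Nat.card K = 6 := by
    generalize Nat.card K = n at *
    interval_cases n
    · exact absurd rfl h1
    · exact absurd (by norm_num) hnp
    · exact absurd (by norm_num) hnp
    · exact Or.inl rfl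
    · exact absurd (by norm_num) hnp
    · exact Or.inr rfl
  refine hc4.imp (fun h4 => ⟨h4, fun y hy => ?_⟩) id
  by_contra hyy
  have hord : orderOf (⟨y, hy⟩ : K) = 4 := by
    have hdvd : orderOf (⟨y, hy⟩ : K) ∣ 2 ^ 2 := by
      have := orderOf_dvd_natCard (⟨y, hy⟩ : K)
      rw [h4] at this
      exact this
    obtain ⟨j, hj, hj'⟩ := (Nat.dvd_prime_pow Nat.prime_two).1 hdvd
    have h5 : ¬ orderOf (⟨y, hy⟩ : K) ∣ 2 := by
      intro h6
      have := orderOf_dvd_iff_pow_eq_one.1 h6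
      rw [pow_two] at this
      exact hyy (congrArg Subtype.val this)
    rw [hj'] at h5 ⊢
    interval_cases j
    · exact absurd (by norm_num) h5
    · exact absurd (by norm_num) h5
    · rfl
  obtain ⟨x, hx, hxX⟩ := ns (y * y) (K.mul_mem hy hy) hyy
  refine hxX (hX x ?_)
  intro k hk hkx
  by_contra hk1
  have htop : Subgroup.zpowers (⟨y, hy⟩ : K) = ⊤ := by
    apply Subgroup.eq_top_of_card_eq
    rw [Nat.card_zpowers, hord, h4]
  have h1 : (⟨k, hk⟩ : K) ∈ Subgroup.zpowers (⟨y, hy⟩ : K) := by rw [htop]; trivial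
  have hy4 : y ^ (4 : ℤ) = 1 := by
    have := pow_orderOf_eq_one (⟨y, hy⟩ : K)
    rw [hord] at this
    have h := congrArg Subtype.val this
    have h' : y ^ 4 = 1 := h
    exact_mod_cast h'
  obtain ⟨i, hi⟩ := Subgroup.mem_zpowers_iff.1 h1
  have h2 : y ^ i = k := congrArg Subtype.val hi
  have h3 : k * k ∈ ({1, y * y} : Set (Perm Ω)) ∧ (k * k = 1 → k = 1 ∨ k = y * y) := by
    have hq : y ^ i = y ^ (i % 4) := by
      conv_lhs => rw [← Int.emod_add_mul_ediv i 4, zpow_add, zpow_mul, hy4, one_zpow, mul_one]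
    have hr : i % 4 = 0 ∨ i % 4 = 1 ∨ i % 4 = 2 ∨ i % 4 = 3 := by omega
    have h22 : y * y * (y * y) = 1 := by
      have : y * y * (y * y) = y ^ (4 : ℤ) := by
        rw [← zpow_two y, ← zpow_add]; rfl
      rw [this, hy4]
    rw [← h2, hq]
    rcases hr with hr | hr | hr | hr <;> rw [hr]
    · simp
    · simp [hyy]
    · have : y ^ (2 : ℤ) = y * y := zpow_two y
      rw [this]
      simp [h22]
    · have h33 : y ^ (3 : ℤ) * y ^ (3 : ℤ) = y * y := by
        have : y ^ (3 : ℤ) * y ^ (3 : ℤ) = (y * y) * y ^ (4 : ℤ) := by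
          rw [← zpow_two y, ← zpow_add, ← zpow_add]; rfl
        rw [this, hy4, mul_one]
      rw [h33]
      simp [hyy]
  have hkk : (k * k) x = x := by rw [Perm.mul_apply, hkx, hkx]
  rcases h3.1 with h5 | h5
  · rcases h3.2 h5 with h6 | h6
    · exact hk1 h6
    · rw [h6] at hkx; exact hx hkx
  · rw [Set.mem_singleton_iff] at h5
    rw [h5] at hkk; exact hx hkk

/-- good points of an edge -/
structure Good (G : Subgroup (Perm Ω)) (F A : Finset Ω) (e : Ω) : Prop where
  eF : Edge G F
  mem : e ∈ F
  disj : Disjoint F A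
  cA : A.card ≤ 5
  reg : ∀ x, Reg (Fx G (F.erase e)) x → x ∈ insert e A
  ns : ∀ s ∈ Fx G (F.erase e), s ≠ 1 → ∃ x, s x ≠ x ∧ x ∉ insert e A

/-- orbit of `e` under the stabiliser of the rest of `F` -/
noncomputable def P (G : Subgroup (Perm Ω)) (F : Finset Ω) (e : Ω) : Finset Ω :=
  orb (Fx G (F.erase e)) e

theorem Good.cases {G : Subgroup (Perm Ω)} {F A : Finset Ω} {e : Ω} (h : Good G F A e) :
    ((P G F e).card = 4 ∧ ∀ g ∈ Fx G (F.erase e), g * g = 1) ∨ (P G F e).card = 6 := by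
  have := card_cases (h.eF.reg (e := e)) h.reg
    ((Finset.card_insert_le _ _).trans (Nat.succ_le_succ h.cA)) (h.eF.exists_move h.mem) h.ns
  rw [P, orb_card h.eF.reg]
  exact this

theorem Good.card_ge {G : Subgroup (Perm Ω)} {F A : Finset Ω} {e : Ω} (h : Good G F A e) :
    4 ≤ (P G F e).card := by
  rcases h.cases with h | h <;> omega

theorem mem_P {G : Subgroup (Perm Ω)} {F : Finset Ω} {e x : Ω} :
    x ∈ P G F e ↔ ∃ g ∈ Fx G (F.erase e), g e = x := mem_orb

theorem self_mem_P (G : Subgroup (Perm Ω)) (F : Finset Ω) (e : Ω) : e ∈ P G F e :=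
  self_mem_orb _ _

theorem Good.reg_iff {G : Subgroup (Perm Ω)} {F A : Finset Ω} {e : Ω} (h : Good G F A e) {x : Ω} :
    x ∈ P G F e ↔ Reg (Fx G (F.erase e)) x := by
  constructor
  · intro hx
    obtain ⟨g, hg, rfl⟩ := mem_P.1 hx
    exact reg_smul h.eF.reg hg
  · intro hx
    by_contra hxP
    have hd : Disjoint (P G F e) (orb (Fx G (F.erase e)) x) := by
      rw [Finset.disjoint_left]
      intro y hy hy'
      obtain ⟨g, hg, rfl⟩ := mem_P.1 hy
      obtain ⟨k, hk, hke⟩ := mem_orb.1 hy'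
      apply hxP
      refine mem_P.2 ⟨k⁻¹ * g, (Fx G (F.erase e)).mul_mem ((Fx G (F.erase e)).inv_mem hk) hg, ?_⟩
      rw [Perm.mul_apply, ← hke, inv_ap]
    have hsub : P G F e ∪ orb (Fx G (F.erase e)) x ⊆ insert e A := by
      intro y hy
      rcases Finset.mem_union.1 hy with hy | hy
      · obtain ⟨g, hg, rfl⟩ := mem_P.1 hy
        exact h.reg _ (reg_smul h.eF.reg hg)
      · obtain ⟨g, hg, rfl⟩ := mem_orb.1 hy
        exact h.reg _ (reg_smul hx hg)
    have h1 := Finset.card_le_card hsub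
    rw [Finset.card_union_of_disjoint hd, orb_card hx, ← orb_card (h.eF.reg (e := e))] at h1
    have h2 := Finset.card_insert_le e A
    have h3 := h.cA
    have h4 := h.card_ge
    unfold P at h1 h4
    omega

theorem Good.sub {G : Subgroup (Perm Ω)} {F A : Finset Ω} {e : Ω} (h : Good G F A e) :
    (P G F e).erase e ⊆ A := by
  intro x hx
  obtain ⟨h1, h2⟩ := Finset.mem_erase.1 hx
  rcases Finset.mem_insert.1 (h.reg x (h.reg_iff.1 h2)) with h3 | h3
  · exact absurd h3 h1
  · exact h3

theorem P_trans {G : Subgroup (Perm Ω)} {F : Finset Ω} {e x y : Ω}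
    (hx : x ∈ P G F e) (hy : y ∈ P G F e) : ∃ g ∈ Fx G (F.erase e), g x = y := by
  obtain ⟨g, hg, rfl⟩ := mem_P.1 hx
  obtain ⟨k, hk, rfl⟩ := mem_P.1 hy
  refine ⟨k * g⁻¹, (Fx G (F.erase e)).mul_mem hk ((Fx G (F.erase e)).inv_mem hg), ?_⟩
  rw [Perm.mul_apply, inv_ap]

theorem P_stable {G : Subgroup (Perm Ω)} {F : Finset Ω} {e x : Ω}
    (hx : x ∈ P G F e) {g : Perm Ω} (hg : g ∈ Fx G (F.erase e)) : g x ∈ P G F e := by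
  obtain ⟨k, hk, rfl⟩ := mem_P.1 hx
  exact mem_P.2 ⟨g * k, (Fx G (F.erase e)).mul_mem hg hk, rfl⟩

/-- swapping two good points -/
theorem exists_swap {G : Subgroup (Perm Ω)} {F A : Finset Ω} {e f : Ω} (he : Good G F A e)
    (hf : Good G F A f) (hef : e ≠ f) :
    ∃ s ∈ G, s e = f ∧ s f = e ∧ ∀ x ∈ F, x ≠ e → x ≠ f → s x = x := by
  have hne : ((P G F e).erase e ∩ (P G F f).erase f).Nonempty := by
    rw [← Finset.card_pos]
    have h1 := Finset.card_union_add_card_inter ((P G F e).erase e) ((P G F f).erase f)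
    have h2 := Finset.card_le_card (Finset.union_subset he.sub hf.sub)
    have h3 := Finset.card_erase_of_mem (self_mem_P G F e)
    have h4 := Finset.card_erase_of_mem (self_mem_P G F f)
    have h5 := he.card_ge
    have h6 := hf.card_ge
    have h7 := he.cA
    omega
  obtain ⟨a, ha⟩ := hne
  simp only [Finset.mem_inter, Finset.mem_erase] at ha
  obtain ⟨g1, hg1, hg1e⟩ := mem_P.1 ha.1.2
  obtain ⟨g2, hg2, hg2f⟩ := mem_P.1 ha.2.2
  set g := g2⁻¹ * g1 with hgdef
  have hgG : g ∈ G := G.mul_mem (G.inv_mem hg2.1) hg1.1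
  have hge : g e = f := by
    rw [hgdef, Perm.mul_apply, hg1e, ← hg2f, inv_ap]
  have hgfix : ∀ x ∈ F, x ≠ e → x ≠ f → g x = x := by
    intro x hx hxe hxf
    rw [hgdef, Perm.mul_apply, hg1.2 x (Finset.mem_erase.2 ⟨hxe, hx⟩), Perm.inv_eq_iff_eq,
      hg2.2 x (Finset.mem_erase.2 ⟨hxf, hx⟩)]
  have hreg : g f ∈ P G F e := by
    rw [he.reg_iff]
    intro k hk hkf
    have hkf' : k f = f := hk.2 f (Finset.mem_erase.2 ⟨hef.symm, hf.mem⟩)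
    have h1 : g⁻¹ * k * g = 1 := by
      refine he.eF.base (G.mul_mem (G.mul_mem (G.inv_mem hgG) hk.1) hgG) (fun x hx => ?_)
      rw [Perm.mul_apply, Perm.mul_apply]
      by_cases hxe : x = e
      · rw [hxe, hge, hkf', ← hge, inv_ap]
      by_cases hxf : x = f
      · rw [hxf, hkf, inv_ap]
      rw [hgfix x hx hxe hxf, hk.2 x (Finset.mem_erase.2 ⟨hxe, hx⟩), Perm.inv_eq_iff_eq,
        hgfix x hx hxe hxf]
    have : k = g * (g⁻¹ * k * g) * g⁻¹ := by group
    rw [this, h1]; group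
  obtain ⟨k, hk, hke⟩ := P_trans hreg (self_mem_P G F e)
  refine ⟨k * g, G.mul_mem hk.1 hgG, ?_, ?_, ?_⟩
  · rw [Perm.mul_apply, hge, hk.2 f (Finset.mem_erase.2 ⟨hef.symm, hf.mem⟩)]
  · rw [Perm.mul_apply, hke]
  · intro x hx hxe hxf
    rw [Perm.mul_apply, hgfix x hx hxe hxf, hk.2 x (Finset.mem_erase.2 ⟨hxe, hx⟩)]

/-- equivariance -/
theorem P_equiv {G : Subgroup (Perm Ω)} {F : Finset Ω} {s : Perm Ω} (hs : s ∈ G)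
    (hsF : ∀ x, s x ∈ F ↔ x ∈ F) {e x : Ω} : s x ∈ P G F (s e) ↔ x ∈ P G F e := by
  constructor
  · intro h
    obtain ⟨g, hg, hgx⟩ := mem_P.1 h
    refine mem_P.2 ⟨s⁻¹ * g * s, ⟨G.mul_mem (G.mul_mem (G.inv_mem hs) hg.1) hs, ?_⟩, ?_⟩
    · intro y hy
      obtain ⟨h1, h2⟩ := Finset.mem_erase.1 hy
      rw [Perm.mul_apply, Perm.mul_apply, hg.2 (s y) (Finset.mem_erase.2
        ⟨fun h => h1 (s.injective h), (hsF y).2 h2⟩), inv_ap]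
    · rw [Perm.mul_apply, Perm.mul_apply, hgx, inv_ap]
  · intro h
    obtain ⟨g, hg, rfl⟩ := mem_P.1 h
    refine mem_P.2 ⟨s * g * s⁻¹, ⟨G.mul_mem (G.mul_mem hs hg.1) (G.inv_mem hs), ?_⟩, ?_⟩
    · intro y hy
      obtain ⟨h1, h2⟩ := Finset.mem_erase.1 hy
      have h3 : s⁻¹ y ∈ F.erase e := by
        refine Finset.mem_erase.2 ⟨fun h => h1 ?_, (hsF _).1 (by simpa using h2)⟩
        rw [← h, ap_inv]
      rw [Perm.mul_apply, Perm.mul_apply, hg.2 _ h3, ap_inv]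
    · rw [Perm.mul_apply, Perm.mul_apply, inv_ap]


theorem Edge.eq_of_agree {G : Subgroup (Perm Ω)} {F : Finset Ω} (hF : Edge G F)
    {g h k : Perm Ω} (hg : g ∈ G) (hh : h ∈ G) (hk : k ∈ G)
    (H : ∀ x ∈ F, g (k x) = h (k x)) : g = h := by
  have h1 : k⁻¹ * h⁻¹ * g * k = 1 := by
    refine hF.base (G.mul_mem (G.mul_mem (G.mul_mem (G.inv_mem hk) (G.inv_mem hh)) hg) hk) ?_
    intro x hx
    simp only [Perm.mul_apply]
    rw [H x hx, inv_ap, inv_ap]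
  have h2 : g = h * (k * (k⁻¹ * h⁻¹ * g * k) * k⁻¹) := by group
  rw [h2, h1]; group

theorem move2 {G : Subgroup (Perm Ω)} {F A : Finset Ω} {e f : Ω} (he : Good G F A e)
    (hf : Good G F A f) (hef : e ≠ f) (hA : (P G F e).erase e = (P G F f).erase f)
    {a a' : Ω} (ha : a ∈ (P G F e).erase e) (ha' : a' ∈ (P G F e).erase e) (haa : a ≠ a') :
    ∃ g ∈ G, g e = a ∧ g f = a' ∧ ∀ x ∈ F, x ≠ e → x ≠ f → g x = x := by
  have haf := hA ▸ ha
  have haf' := hA ▸ ha'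
  obtain ⟨z, hz, hzf⟩ := mem_P.1 (Finset.mem_erase.1 haf').2
  have h1 : z⁻¹ a ∈ (P G F f).erase f := by
    refine Finset.mem_erase.2 ⟨fun h => haa ?_, P_stable (Finset.mem_erase.1 haf).2
      ((Fx G (F.erase f)).inv_mem hz)⟩
    rw [← hzf, ← h, ap_inv]
  rw [← hA] at h1
  obtain ⟨y, hy, hye⟩ := mem_P.1 (Finset.mem_erase.1 h1).2
  refine ⟨z * y, G.mul_mem hz.1 hy.1, ?_, ?_, ?_⟩
  · rw [Perm.mul_apply, hye, ap_inv]
  · rw [Perm.mul_apply, hy.2 f (Finset.mem_erase.2 ⟨hef.symm, hf.mem⟩), hzf]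
  · intro x hx hxe hxf
    rw [Perm.mul_apply, hy.2 x (Finset.mem_erase.2 ⟨hxe, hx⟩),
      hz.2 x (Finset.mem_erase.2 ⟨hxf, hx⟩)]

theorem sharp2 {G : Subgroup (Perm Ω)} {F A : Finset Ω} {e f : Ω} (he : Good G F A e)
    (hf : Good G F A f) (hef : e ≠ f) (hA : (P G F e).erase e = (P G F f).erase f)
    {a a' : Ω} (ha : a ∈ (P G F e).erase e) (ha' : a' ∈ (P G F e).erase e) (haa : a ≠ a')
    {g h : Perm Ω} (hg : g ∈ G) (hh : h ∈ G) (H : ∀ x ∈ F, x ≠ e → x ≠ f → g x = h x)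
    (H1 : g a = h a) (H2 : g a' = h a') : g = h := by
  obtain ⟨k, hk, hke, hkf, hkx⟩ := move2 he hf hef hA ha ha' haa
  refine he.eF.eq_of_agree hg hh hk (fun x hx => ?_)
  by_cases hxe : x = e
  · rw [hxe, hke, H1]
  by_cases hxf : x = f
  · rw [hxf, hkf, H2]
  rw [hkx x hx hxe hxf, H x hx hxe hxf]

theorem sharp3 {G : Subgroup (Perm Ω)} {F A : Finset Ω} {e f d : Ω} (he : Good G F A e)
    (hf : Good G F A f) (hd : Good G F A d) (hef : e ≠ f) (hed : e ≠ d) (hfd : f ≠ d)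
    (hA : (P G F e).erase e = (P G F f).erase f) (hA' : (P G F e).erase e = (P G F d).erase d)
    {a a' b : Ω} (ha : a ∈ (P G F e).erase e) (ha' : a' ∈ (P G F e).erase e)
    (hb : b ∈ (P G F e).erase e) (haa : a ≠ a') (hab : a ≠ b) (hab' : a' ≠ b)
    {g h : Perm Ω} (hg : g ∈ G) (hh : h ∈ G)
    (H : ∀ x ∈ F, x ≠ e → x ≠ f → x ≠ d → g x = h x)
    (H1 : g a = h a) (H2 : g a' = h a') (H3 : g b = h b) : g = h := by
  have hbd := hA' ▸ hb
  obtain ⟨z, hz, hzd⟩ := mem_P.1 (Finset.mem_erase.1 hbd).2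
  have key : ∀ c ∈ (P G F e).erase e, c ≠ b → z⁻¹ c ∈ (P G F e).erase e := by
    intro c hc hcb
    rw [hA'] at hc ⊢
    refine Finset.mem_erase.2 ⟨fun h => hcb ?_, P_stable (Finset.mem_erase.1 hc).2
      ((Fx G (F.erase d)).inv_mem hz)⟩
    rw [← hzd, ← h, ap_inv]
  obtain ⟨k, hk, hke, hkf, hkx⟩ := move2 he hf hef hA (key a ha hab) (key a' ha' hab')
    (fun h => haa (z⁻¹.injective h))
  refine he.eF.eq_of_agree hg hh (G.mul_mem hz.1 hk) (fun x hx => ?_)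
  rw [Perm.mul_apply]
  by_cases hxe : x = e
  · rw [hxe, hke, ap_inv, H1]
  by_cases hxf : x = f
  · rw [hxf, hkf, ap_inv, H2]
  rw [hkx x hx hxe hxf]
  by_cases hxd : x = d
  · rw [hxd, hzd, H3]
  rw [hz.2 x (Finset.mem_erase.2 ⟨hxd, hx⟩), H x hx hxe hxf hxd]

theorem pair4 {G : Subgroup (Perm Ω)} {F A : Finset Ω} {e f : Ω} (he : Good G F A e)
    (hf : Good G F A f) (hef : e ≠ f) (hce : (P G F e).card = 4)
    (hA : (P G F e).erase e = (P G F f).erase f) : False := by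
  have h3 : ((P G F e).erase e).card = 3 := by
    rw [Finset.card_erase_of_mem (self_mem_P G F e), hce]
  have h3' : (P G F f).card = 4 := by
    have := Finset.card_erase_of_mem (self_mem_P G F f)
    rw [← hA, h3] at this
    omega
  obtain ⟨a, b, c, hab, hac, hbc, hS⟩ := Finset.card_eq_three.1 h3
  have key : ∀ {e : Ω}, Good G F A e → (P G F e).card = 4 → (P G F e).erase e = {a, b, c} →
      ∃ y ∈ Fx G (F.erase e), y e = a ∧ y b = c ∧ y c = b := by
    intro e he hce hS
    have h2 : ∀ g ∈ Fx G (F.erase e), g * g = 1 := by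
      rcases he.cases with h | h
      · exact h.2
      · omega
    have hmem : ∀ x, x ∈ P G F e ↔ x = e ∨ x = a ∨ x = b ∨ x = c := by
      intro x
      have h := congrArg (fun S => x ∈ S) hS
      simp only [Finset.mem_erase, Finset.mem_insert, Finset.mem_singleton, eq_iff_iff] at h
      by_cases hx : x = e
      · simp [hx, self_mem_P]
      · simpa [hx] using h
    have hna : a ≠ e := by
      have : a ∈ (P G F e).erase e := by simp [hS]
      exact (Finset.mem_erase.1 this).1
    have hnb : b ≠ e := by
      have : b ∈ (P G F e).erase e := by simp [hS]
      exact (Finset.mem_erase.1 this).1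
    obtain ⟨y, hy, hye⟩ := mem_P.1 ((hmem a).2 (by simp))
    have hyy : ∀ x, y (y x) = x := fun x => by
      rw [← Perm.mul_apply, h2 y hy]; rfl
    have hya : y a = e := by rw [← hye, hyy]
    have hb : b ∈ P G F e := (hmem b).2 (by simp)
    have hyb : y b = c := by
      rcases (hmem _).1 (P_stable hb hy) with h | h | h | h
      · exact absurd (y.injective (h.trans hya.symm)) hab.symm
      · exact absurd (y.injective (h.trans hye.symm)) hnb
      · have h1 := he.reg_iff.1 hb y hy h
        rw [h1] at hye
        exact absurd hye.symm hna
      · exact h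
    exact ⟨y, hy, hye, hyb, by rw [← hyb, hyy]⟩
  obtain ⟨y, hy, hye, hyb, hyc⟩ := key he hce hS
  obtain ⟨z, hz, hzf, hzb, hzc⟩ := key hf h3' (hA ▸ hS)
  have hb : b ∈ (P G F e).erase e := by simp [hS]
  have hc : c ∈ (P G F e).erase e := by simp [hS]
  have ha : a ∈ (P G F e).erase e := by simp [hS]
  have h1 : y * z = 1 := by
    refine sharp2 he hf hef hA hb hc hbc (G.mul_mem hy.1 hz.1) G.one_mem ?_ ?_ ?_
    · intro x hx hxe hxf
      rw [Perm.mul_apply, hz.2 x (Finset.mem_erase.2 ⟨hxf, hx⟩),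
        hy.2 x (Finset.mem_erase.2 ⟨hxe, hx⟩)]; rfl
    · rw [Perm.mul_apply, hzb, hyc]; rfl
    · rw [Perm.mul_apply, hzc, hyb]; rfl
  have h2 : (y * z) e = a := by
    rw [Perm.mul_apply, hz.2 e (Finset.mem_erase.2 ⟨hef, he.mem⟩), hye]
  rw [h1] at h2
  exact (Finset.mem_erase.1 ha).1 h2.symm

set_option synthInstance.maxHeartbeats 400000 in
set_option synthInstance.maxSize 2000 in
set_option maxRecDepth 4000 in
theorem fin5 : ∀ B1 ∈ Finset.powersetCard 3 (Finset.univ : Finset (Fin 5)),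
    ∀ B2 ∈ Finset.powersetCard 3 (Finset.univ : Finset (Fin 5)), B1 ≠ B2 →
    ∀ B3 ∈ Finset.powersetCard 3 (Finset.univ : Finset (Fin 5)), B1 ≠ B3 → B2 ≠ B3 → 
      (B1 ∩ B2).card = (B1 ∩ B3).card → (B1 ∩ B2).card = (B2 ∩ B3).card → 
    ∀ B4 ∈ Finset.powersetCard 3 (Finset.univ : Finset (Fin 5)), B1 ≠ B4 → B2 ≠ B4 → B3 ≠ B4 →
      (B1 ∩ B2).card = (B1 ∩ B4).card → (B1 ∩ B2).card = (B2 ∩ B4).card → 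
      (B1 ∩ B2).card = (B3 ∩ B4).card → 
    ∀ B5 ∈ Finset.powersetCard 3 (Finset.univ : Finset (Fin 5)), B1 ≠ B5 → B2 ≠ B5 → B3 ≠ B5 →
      B4 ≠ B5 →
      (B1 ∩ B2).card = (B1 ∩ B5).card → (B1 ∩ B2).card = (B2 ∩ B5).card → 
      (B1 ∩ B2).card = (B3 ∩ B5).card → (B1 ∩ B2).card = (B4 ∩ B5).card → False := by
  decide +kernel

theorem five_sets {A : Finset Ω} (hA : A.card ≤ 5) (B : Fin 5 → Finset Ω) (hB : ∀ i, B i ⊆ A)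
    (h3 : ∀ i, (B i).card = 3) (hne : ∀ i j, i ≠ j → B i ≠ B j)
    (hc : ∀ i j k, i ≠ j → i ≠ k → j ≠ k → (B i ∩ B j).card = (B i ∩ B k).card) : False := by
  obtain ⟨φ, hφ⟩ : ∃ φ : Ω → Fin 5, Set.InjOn φ A := by
    refine ⟨fun x => if h : x ∈ A then Fin.castLE hA (A.equivFin ⟨x, h⟩) else 0, ?_⟩
    intro x hx y hy hxy
    have hx' : x ∈ A := hx
    have hy' : y ∈ A := hy
    simp only [hx', hy', dif_pos] at hxy
    have h1 := A.equivFin.injective (Fin.castLE_injective hA hxy)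
    exact congrArg Subtype.val h1
  have hi : ∀ i j, ((B i).image φ ∩ (B j).image φ).card = (B i ∩ B j).card := by
    intro i j
    rw [← Finset.image_inter_of_injOn, Finset.card_image_of_injOn]
    · exact hφ.mono (fun x hx => hB i (Finset.mem_inter.1 hx).1)
    · refine hφ.mono (fun x hx => ?_)
      rcases hx with hx | hx
      · exact hB i hx
      · exact hB j hx
  have hm : ∀ i, (B i).image φ ∈ Finset.powersetCard 3 (Finset.univ : Finset (Fin 5)) := by
    intro i
    rw [Finset.mem_powersetCard]
    refine ⟨Finset.subset_univ _, ?_⟩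
    rw [Finset.card_image_of_injOn (hφ.mono (hB i)), h3]
  have hn : ∀ i j, i ≠ j → (B i).image φ ≠ (B j).image φ := by
    intro i j hij h
    have h1 := hi i j
    rw [← h, Finset.inter_self, Finset.card_image_of_injOn (hφ.mono (hB i))] at h1
    have h2 : B i ∩ B j = B i := Finset.eq_of_subset_of_card_le Finset.inter_subset_left h1.le
    have h4 : B i ⊆ B j := Finset.inter_eq_left.1 h2
    exact hne i j hij (Finset.eq_of_subset_of_card_le h4 (by rw [h3, h3]))
  have hcc : ∀ i j k l, i ≠ j → k ≠ l → ((B i).image φ ∩ (B j).image φ).card =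
      ((B k).image φ ∩ (B l).image φ).card := by
    intro i j k l hij hkl
    rw [hi, hi]
    have hc' : ∀ i j k, i ≠ j → i ≠ k → (B i ∩ B j).card = (B i ∩ B k).card := by
      intro i j k hij hik
      by_cases hjk : j = k
      · rw [hjk]
      · exact hc i j k hij hik hjk
    by_cases hik : i = k
    · subst hik
      exact hc' i j l hij hkl
    · rw [hc' i j k hij hik, Finset.inter_comm, hc' k i l (Ne.symm hik) hkl]
  exact fin5 _ (hm 0) _ (hm 1) (hn 0 1 (by decide)) _ (hm 2) (hn 0 2 (by decide))
    (hn 1 2 (by decide)) (hcc 0 1 0 2 (by decide) (by decide)) (hcc 0 1 1 2 (by decide) (by decide))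
    _ (hm 3) (hn 0 3 (by decide)) (hn 1 3 (by decide)) (hn 2 3 (by decide))
    (hcc 0 1 0 3 (by decide) (by decide)) (hcc 0 1 1 3 (by decide) (by decide))
    (hcc 0 1 2 3 (by decide) (by decide))
    _ (hm 4) (hn 0 4 (by decide)) (hn 1 4 (by decide)) (hn 2 4 (by decide)) (hn 3 4 (by decide))
    (hcc 0 1 0 4 (by decide) (by decide)) (hcc 0 1 1 4 (by decide) (by decide))
    (hcc 0 1 2 4 (by decide) (by decide)) (hcc 0 1 3 4 (by decide) (by decide))

theorem swap_pres {F : Finset Ω} {s : Perm Ω} {e f : Ω} (he : e ∈ F) (hf : f ∈ F)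
    (h1 : s e = f) (h2 : s f = e) (h3 : ∀ x ∈ F, x ≠ e → x ≠ f → s x = x) (x : Ω) :
    s x ∈ F ↔ x ∈ F := by
  have key : ∀ y ∈ F, s y ∈ F ∧ s (s y) = y := by
    intro y hy
    by_cases hye : y = e
    · subst hye; rw [h1, h2]; exact ⟨hf, rfl⟩
    by_cases hyf : y = f
    · subst hyf; rw [h2, h1]; exact ⟨he, rfl⟩
    rw [h3 y hy hye hyf, h3 y hy hye hyf]
    exact ⟨hy, rfl⟩
  constructor
  · intro h
    have := (key _ h)
    rw [s.injective this.2] at this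
    exact this.1 |> fun h => by
      have h4 := (key _ ‹s x ∈ F›)
      have h5 : s (s x) = x := s.injective h4.2
      rw [← h5]; exact h4.1
  · intro h
    exact (key x h).1

theorem card_P_eq {G : Subgroup (Perm Ω)} {F A : Finset Ω} {e f : Ω} (he : Good G F A e)
    (hf : Good G F A f) : (P G F e).card = (P G F f).card := by
  by_cases hef : e = f
  · rw [hef]
  obtain ⟨s, hs, h1, h2, h3⟩ := exists_swap he hf hef
  have hp := swap_pres he.mem hf.mem h1 h2 h3
  apply le_antisymm
  · refine Finset.card_le_card_of_injOn s (fun x hx => ?_) s.injective.injOn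
    rw [← h1]; exact (P_equiv hs hp).2 hx
  · refine Finset.card_le_card_of_injOn s (fun x hx => ?_) s.injective.injOn
    rw [← h2]; exact (P_equiv hs hp).2 hx

theorem inter_le {G : Subgroup (Perm Ω)} {F A : Finset Ω} {e f d : Ω} (he : Good G F A e)
    (hf : Good G F A f) (hd : Good G F A d) (hef : e ≠ f) (hed : e ≠ d) (hfd : f ≠ d) :
    ((P G F e).erase e ∩ (P G F f).erase f).card ≤ ((P G F e).erase e ∩ (P G F d).erase d).card := by
  obtain ⟨s, hs, h1, h2, h3⟩ := exists_swap hf hd hfd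
  have hp := swap_pres hf.mem hd.mem h1 h2 h3
  have hse := h3 e he.mem hef hed
  refine Finset.card_le_card_of_injOn s (fun x hx => ?_) s.injective.injOn
  have hx' : x ∈ (P G F e).erase e ∩ (P G F f).erase f := hx
  simp only [Finset.mem_inter, Finset.mem_erase] at hx'
  obtain ⟨⟨k1, k2⟩, k3, k4⟩ := hx'
  have m1 := (P_equiv hs hp).2 k2
  have m2 := (P_equiv hs hp).2 k4
  rw [hse] at m1
  rw [h1] at m2
  show s x ∈ (P G F e).erase e ∩ (P G F d).erase d
  simp only [Finset.mem_inter, Finset.mem_erase]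
  refine ⟨⟨fun h => k1 (s.injective (h.trans hse.symm)), m1⟩,
    fun h => k3 (s.injective (h.trans h1.symm)), m2⟩

/-- package for the case of orbits of size six -/
theorem swap6 {G : Subgroup (Perm Ω)} {F A : Finset Ω} {e f : Ω} (he : Good G F A e)
    (hf : Good G F A f) (hef : e ≠ f) (hA5 : A.card = 5) (hAe : (P G F e).erase e = A)
    (hAf : (P G F f).erase f = A) :
    ∃ s ∈ G, s e = f ∧ s f = e ∧ (∀ x ∈ F, x ≠ e → x ≠ f → s x = x) ∧ (∀ x, s (s x) = x) ∧
      (∀ x ∈ A, s x ∈ A) ∧ (∃ a ∈ A, s a = a) ∧ ∀ a ∈ A, ∀ b ∈ A, s a = a → s b = b → a = b := by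
  obtain ⟨s, hs, h1, h2, h3⟩ := exists_swap he hf hef
  have hp := swap_pres he.mem hf.mem h1 h2 h3
  have hss : s * s = 1 := by
    refine he.eF.eq_of_agree (k := 1) (G.mul_mem hs hs) G.one_mem G.one_mem (fun x hx => ?_)
    simp only [Perm.one_apply, Perm.mul_apply]
    by_cases hye : x = e
    · subst hye; rw [h1, h2]
    by_cases hyf : x = f
    · subst hyf; rw [h2, h1]
    rw [h3 x hx hye hyf, h3 x hx hye hyf]
  have hss' : ∀ x, s (s x) = x := fun x => by rw [← Perm.mul_apply, hss]; rfl
  have hsA : ∀ x ∈ A, s x ∈ A := by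
    intro x hx
    rw [← hAe] at hx
    obtain ⟨k1, k2⟩ := Finset.mem_erase.1 hx
    rw [← hAf]
    have := (P_equiv hs hp).2 k2
    rw [h1] at this
    exact Finset.mem_erase.2 ⟨fun h => k1 (s.injective (h.trans h1.symm)), this⟩
  refine ⟨s, hs, h1, h2, h3, hss', hsA, ?_, ?_⟩
  · by_contra hcon
    push Not at hcon
    have := Finset.prod_involution (s := A) (f := fun _ => (-1 : ℤ)) (fun x _ => s x)
      (fun x _ => by norm_num) (fun x hx _ => hcon x hx) hsA (fun x _ => hss' x)
    rw [Finset.prod_const, hA5] at this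
    norm_num at this
  · intro a ha b hb hsa hsb
    by_contra hab
    rw [← hAe] at ha hb
    have : s = 1 := sharp2 he hf hef (hAe.trans hAf.symm) ha hb hab hs G.one_mem
      (fun x hx hxe hxf => h3 x hx hxe hxf) hsa hsb
    rw [this] at h1
    exact hef h1

theorem main2 {G : Subgroup (Perm Ω)} {F A T : Finset Ω} (hT : 5 ≤ T.card)
    (hG : ∀ e ∈ T, Good G F A e) : False := by
  obtain ⟨t, ht⟩ : ∃ t : Fin 5 ↪ Ω, ∀ i, t i ∈ T := by
    refine ⟨⟨fun i => T.equivFin.symm (Fin.castLE hT i), ?_⟩, fun i => (T.equivFin.symm (Fin.castLE hT i)).2⟩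
    intro i j hij
    exact Fin.castLE_injective hT (T.equivFin.symm.injective (Subtype.ext hij))
  have g : ∀ i, Good G F A (t i) := fun i => hG _ (ht i)
  have tn : ∀ {i j}, i ≠ j → t i ≠ t j := fun h h' => h (t.injective h')
  rcases (g 0).cases with h4 | h6
  · have hc4 : ∀ i, (P G F (t i)).card = 4 := fun i => (card_P_eq (g i) (g 0)).trans h4.1
    refine five_sets (g 0).cA (fun i => (P G F (t i)).erase (t i)) (fun i => (g i).sub) ?_ ?_ ?_
    · intro i
      rw [Finset.card_erase_of_mem (self_mem_P G F _), hc4]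
    · intro i j hij h
      exact pair4 (g i) (g j) (tn hij) (hc4 i) h
    · intro i j k hij hik hjk
      exact le_antisymm (inter_le (g i) (g j) (g k) (tn hij) (tn hik) (tn hjk))
        (inter_le (g i) (g k) (g j) (tn hik) (tn hij) (tn hjk.symm))
  · have hc6 : ∀ i, (P G F (t i)).card = 6 := fun i => (card_P_eq (g i) (g 0)).trans h6
    have hA : ∀ i, (P G F (t i)).erase (t i) = A := by
      intro i
      refine Finset.eq_of_subset_of_card_le (g i).sub ?_
      rw [Finset.card_erase_of_mem (self_mem_P G F _), hc6]
      exact (g 0).cA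
    have hA5 : A.card = 5 := by
      rw [← hA 0, Finset.card_erase_of_mem (self_mem_P G F _), hc6]
    have sw : ∀ i j, i ≠ j → _ := fun i j hij => swap6 (g i) (g j) (tn hij) hA5 (hA i) (hA j)
    obtain ⟨u, hu, u1, u2, u3, uu, uA, ⟨a, ha, hua⟩, uq⟩ := sw 0 1 (by decide)
    obtain ⟨v, hv, v1, v2, v3, vv, vA, -, vq⟩ := sw 1 2 (by decide)
    obtain ⟨w, hw, w1, w2, w3, ww, wA, -, wq⟩ := sw 2 3 (by decide)
    obtain ⟨z, hz, z1, z2, z3, zz, zA, -, zq⟩ := sw 0 4 (by decide)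
    have comm : ∀ {i j k l : Fin 5} {p q : Perm Ω}, i ≠ k → i ≠ l → j ≠ k → j ≠ l → p ∈ G → q ∈ G →
        p (t i) = t j → p (t j) = t i → (∀ x ∈ F, x ≠ t i → x ≠ t j → p x = x) →
        q (t k) = t l → q (t l) = t k → (∀ x ∈ F, x ≠ t k → x ≠ t l → q x = x) →
        p * q = q * p := by
      intro i j k l p q hik hil hjk hjl hp hq p1 p2 p3 q1 q2 q3
      refine (g 0).eF.eq_of_agree (k := 1) (G.mul_mem hp hq) (G.mul_mem hq hp) G.one_mem
        (fun x hx => ?_)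
      simp only [Perm.one_apply, Perm.mul_apply]
      have pk := p3 _ (g k).mem (tn hik.symm) (tn hjk.symm)
      have pl := p3 _ (g l).mem (tn hil.symm) (tn hjl.symm)
      have qi := q3 _ (g i).mem (tn hik) (tn hil)
      have qj := q3 _ (g j).mem (tn hjk) (tn hjl)
      by_cases hxi : x = t i
      · rw [hxi, qi, p1, qj]
      by_cases hxj : x = t j
      · rw [hxj, qj, p2, qi]
      by_cases hxk : x = t k
      · rw [hxk, q1, pk, pl, q1]
      by_cases hxl : x = t l
      · rw [hxl, q2, pl, pk, q2]
      rw [q3 x hx hxk hxl, p3 x hx hxi hxj, q3 x hx hxk hxl]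
    have fixp : ∀ {p q : Perm Ω}, p * q = q * p → (∀ x ∈ A, q x ∈ A) →
        (∀ a ∈ A, ∀ b ∈ A, p a = a → p b = b → a = b) → p a = a → q a = a := by
      intro p q hpq hqA hpu hpa
      refine hpu _ (hqA a ha) _ ha ?_ hpa
      rw [← Perm.mul_apply, hpq, Perm.mul_apply, hpa]
    have hwa : w a = a := fixp (comm (by decide) (by decide) (by decide) (by decide) hu hw
      u1 u2 u3 w1 w2 w3) wA uq hua
    have hza : z a = a := fixp (comm (by decide) (by decide) (by decide) (by decide) hw hz
      w1 w2 w3 z1 z2 z3) zA wq hwa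
    have hva : v a = a := fixp (comm (by decide) (by decide) (by decide) (by decide) hz hv
      z1 z2 z3 v1 v2 v3) vA zq hza
    have sh : ∀ {a' b : Ω} {p q : Perm Ω}, a' ∈ A → b ∈ A → a ≠ a' → a ≠ b → a' ≠ b → p ∈ G →
        q ∈ G → (∀ x ∈ F, x ≠ t 0 → x ≠ t 1 → x ≠ t 2 → p x = q x) → p a = q a → p a' = q a' →
        p b = q b → p = q := by
      intro a' b p q ha' hb h1 h2 h3 hp hq
      exact sharp3 (g 0) (g 1) (g 2) (tn (by decide)) (tn (by decide)) (tn (by decide))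
        ((hA 0).trans (hA 1).symm) ((hA 0).trans (hA 2).symm) ((hA 0).symm ▸ ha)
        ((hA 0).symm ▸ ha') ((hA 0).symm ▸ hb) h1 h2 h3 hp hq
    have v0 : v (t 0) = t 0 := v3 _ (g 0).mem (tn (by decide)) (tn (by decide))
    have uB : ∀ x ∈ A, x ≠ a → u x ∈ A ∧ u x ≠ a ∧ u x ≠ x := fun x hx hxa =>
      ⟨uA x hx, fun h => hxa (u.injective (h.trans hua.symm)), fun h => hxa (uq _ hx _ ha h hua)⟩
    have vB : ∀ x ∈ A, x ≠ a → v x ∈ A ∧ v x ≠ a ∧ v x ≠ x := fun x hx hxa =>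
      ⟨vA x hx, fun h => hxa (v.injective (h.trans hva.symm)), fun h => hxa (vq _ hx _ ha h hva)⟩
    have huv : ∀ x ∈ A, x ≠ a → u x ≠ v x := by
      intro x hx hxa h
      have : u = v⁻¹ := by
        refine sh hx (uB x hx hxa).1 hxa.symm (uB x hx hxa).2.1.symm (uB x hx hxa).2.2.symm
          hu (G.inv_mem hv) ?_ ?_ ?_ ?_
        · intro y hy y0 y1 y2
          rw [u3 y hy y0 y1, eq_comm, Perm.inv_eq_iff_eq, v3 y hy y1 y2]
        · rw [hua, eq_comm, Perm.inv_eq_iff_eq, hva]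
        · rw [eq_comm, Perm.inv_eq_iff_eq, h, vv]
        · rw [eq_comm, Perm.inv_eq_iff_eq, uu, h]
      have h0 : u (t 0) = t 0 := by rw [this, Perm.inv_eq_iff_eq, v0]
      rw [u1] at h0
      exact tn (by decide) h0
    have hcomm : ∀ x ∈ A, x ≠ a → (u * v) x = (v * u) x := by
      intro x hx hxa
      obtain ⟨p1, p2, p3⟩ := uB x hx hxa
      obtain ⟨q1, q2, q3⟩ := vB x hx hxa
      have hne := huv x hx hxa
      obtain ⟨r1, r2, r3⟩ := uB _ q1 q2
      obtain ⟨s1, s2, s3⟩ := vB _ p1 p2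
      have hcard : (((((A.erase a).erase x).erase (u x)).erase (v x))).card ≤ 1 := by
        rw [Finset.card_erase_of_mem, Finset.card_erase_of_mem, Finset.card_erase_of_mem,
          Finset.card_erase_of_mem ha, hA5]
        · simp [*]
        · simp [*]
        · simp [*, hne.symm]
      refine Finset.card_le_one.1 hcard _ ?_ _ ?_
      · simp only [Finset.mem_erase, Perm.mul_apply]
        refine ⟨r3, fun h => q3 (u.injective h), fun h => hne ?_, r2, r1⟩
        have := congrArg u h
        rw [uu] at this
        exact this.symm
      · simp only [Finset.mem_erase, Perm.mul_apply]
        refine ⟨fun h => p3 (v.injective h), s3, fun h => hne ?_, s2, s1⟩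
        have := congrArg v h
        rw [vv] at this
        exact this
    obtain ⟨x, hx⟩ : (A.erase a).Nonempty := by
      rw [← Finset.card_pos, Finset.card_erase_of_mem ha, hA5]; norm_num
    obtain ⟨hxa, hx⟩ := Finset.mem_erase.1 hx
    obtain ⟨p1, p2, p3⟩ := uB x hx hxa
    have huvc : u * v = v * u := by
      refine sh hx p1 hxa.symm p2.symm p3.symm (G.mul_mem hu hv) (G.mul_mem hv hu) ?_ ?_ ?_ ?_
      · intro y hy y0 y1 y2
        rw [Perm.mul_apply, Perm.mul_apply, v3 y hy y1 y2, u3 y hy y0 y1, v3 y hy y1 y2]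
      · rw [Perm.mul_apply, Perm.mul_apply, hva, hua, hva]
      · exact hcomm x hx hxa
      · exact hcomm _ p1 p2
    have := congrArg (fun p : Perm Ω => p (t 0)) huvc
    simp only [Perm.mul_apply] at this
    rw [v0, u1, v1] at this
    exact tn (by decide) this

/-- no small supports -/
def NoSmall (G : Subgroup (Perm Ω)) (m : ℕ) (α β : Ω) : Prop :=
  ∀ E F : Finset Ω, MinPair G m α β E F → ∀ e ∈ E ∩ F, ∀ s ∈ Fx G (F.erase e), s ≠ 1 →
    ∃ x, s x ≠ x ∧ x ∉ insert e (E \ F)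

theorem good_of {G : Subgroup (Perm Ω)} {m : ℕ} (hb7 : baseSize G ≤ 7) (h2 : 2 ≤ m) {α β : Ω}
    (hQ : NoSmall G m α β) {E F : Finset Ω} (h : MinPair G m α β E F) {e : Ω} (he : e ∈ E ∩ F)
    (heb : e ≠ β) : Good G F (E \ F) e where
  eF := h.eF
  mem := (Finset.mem_inter.1 he).2
  disj := Finset.disjoint_sdiff
  cA := by
    have h1 := Finset.card_sdiff_add_card_inter E F
    rw [h.hm, h.eE.card] at h1
    omega
  reg := fun x hx => h.exchF h2 he heb hx
  ns := fun s hs hs1 => hQ E F h e he s hs hs1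

theorem main1 {G : Subgroup (Perm Ω)} {m : ℕ} (hb7 : baseSize G ≤ 7) (h2 : 2 ≤ m) {α β : Ω}
    (hQ : NoSmall G m α β) (hQ' : NoSmall G m β α) {E F : Finset Ω} (h : MinPair G m α β E F)
    (hc : 2 ≤ ((E ∩ F).erase α).card) : False := by
  obtain ⟨e, he, f, hf, hef⟩ := Finset.one_lt_card.1 hc
  obtain ⟨hea, heI⟩ := Finset.mem_erase.1 he
  obtain ⟨hfa, hfI⟩ := Finset.mem_erase.1 hf
  have ge : Good G E (F \ E) e := good_of hb7 h2 hQ' h.symm (by rwa [Finset.inter_comm]) hea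
  have gf : Good G E (F \ E) f := good_of hb7 h2 hQ' h.symm (by rwa [Finset.inter_comm]) hfa
  set B := (P G E e).erase e with hB
  set C := (P G E f).erase f with hC
  have cB : B.card = (P G E e).card - 1 := Finset.card_erase_of_mem (self_mem_P G E e)
  have cC : C.card = (P G E f).card - 1 := Finset.card_erase_of_mem (self_mem_P G E f)
  have hcard : (P G E e).card = (P G E f).card := card_P_eq ge gf
  have h4 : 4 ≤ (B ∪ C).card := by
    have l1 := Finset.card_le_card (Finset.subset_union_left : B ⊆ B ∪ C)
    rcases ge.cases with h4 | h6
    · by_contra hlt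
      have e1 : B = B ∪ C := Finset.eq_of_subset_of_card_le Finset.subset_union_left (by omega)
      have e2 : C = B ∪ C := Finset.eq_of_subset_of_card_le Finset.subset_union_right (by omega)
      exact pair4 ge gf hef h4.1 (e1.trans e2.symm)
    · omega
  have hdis : Disjoint (E ∩ F) (B ∪ C) := by
    refine Finset.disjoint_left.2 (fun x hx hx' => ?_)
    have : x ∈ F \ E := Finset.union_subset ge.sub gf.sub hx'
    exact (Finset.mem_sdiff.1 this).2 (Finset.mem_inter.1 hx).1
  have hT : 5 ≤ (((E ∩ F) ∪ (B ∪ C)).erase β).card := by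
    have h5 := Finset.card_union_of_disjoint hdis
    have h6 := Finset.pred_card_le_card_erase (s := (E ∩ F) ∪ (B ∪ C)) (a := β)
    have h7 := h.hm
    omega
  refine main2 (G := G) (F := F) (A := E \ F) hT (fun x hx => ?_)
  obtain ⟨hxb, hx⟩ := Finset.mem_erase.1 hx
  have key : ∀ {e : Ω}, e ∈ E ∩ F → e ≠ α → Good G E (F \ E) e → x ∈ (P G E e).erase e →
      Good G F (E \ F) x := by
    intro e heI hea ge hx
    obtain ⟨k1, k2, k3, k4, k5⟩ := h.moveE h2 heI hea (ge.reg_iff.1 (Finset.mem_erase.1 hx).2)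
    rw [← k2]
    refine good_of hb7 h2 hQ k1 ?_ hxb
    rw [k4]
    exact Finset.mem_insert_self _ _
  rcases Finset.mem_union.1 hx with hx | hx
  · exact good_of hb7 h2 hQ h hx hxb
  rcases Finset.mem_union.1 hx with hx | hx
  · exact key heI hea ge hx
  · exact key hfI hfa gf hx

theorem main0 {G : Subgroup (Perm Ω)} {m : ℕ} (hb7 : baseSize G ≤ 7) (h2 : 2 ≤ m) {α β : Ω}
    (hab : α ≠ β)
    (hQ : NoSmall G m α β) (hQ' : NoSmall G m β α) {E F : Finset Ω} (h : MinPair G m α β E F) :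
    False := by
  by_cases h1 : 2 ≤ ((E ∩ F).erase α).card
  · exact main1 hb7 h2 hQ hQ' h h1
  by_cases hβ : β ∈ E ∩ F
  · have hbb : β ∈ F ∩ E := by rwa [Finset.inter_comm]
    have gb : Good G E (F \ E) β := good_of hb7 h2 hQ' h.symm hbb hab.symm
    obtain ⟨x, hx, hxb⟩ := Finset.exists_mem_ne (s := P G E β) (by have := gb.card_ge; omega) β
    obtain ⟨k1, k2, k3, k4, k5⟩ := h.moveE h2 hβ hab.symm (gb.reg_iff.1 hx)
    refine main1 hb7 h2 hQ' hQ k1.symm ?_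
    rw [Finset.inter_comm, Finset.erase_eq_of_notMem, k1.hm]
    · exact h2
    · rw [k4]
      simp [hxb.symm]
  · refine main1 hb7 h2 hQ' hQ h.symm ?_
    rw [Finset.inter_comm, Finset.erase_eq_of_notMem hβ, h.hm]
    exact h2

theorem final {G : Subgroup (Perm Ω)} (hprim : IsPrimitivePerm G) (hb7 : baseSize G ≤ 7)
    {α β γ : Ω} (hab : α ≠ β) {E F : Finset Ω} (hE : Edge G E) (hF : Edge G F) (ha : α ∈ E)
    (hb : β ∈ F) (hγ : γ ∈ E ∩ F) (hno : ∀ E F : Finset Ω, Edge G E → Edge G F → α ∈ E → β ∈ F →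
      (E ∩ F).card ≠ 1) :
    (G = ⊤ ∧ 4 ≤ Fintype.card Ω) ∨ (G = alternatingGroup Ω ∧ 6 ≤ Fintype.card Ω) := by
  classical
  have hex : ∃ m, 1 ≤ m ∧ ∃ E F : Finset Ω, Edge G E ∧ Edge G F ∧ α ∈ E ∧ β ∈ F ∧
      (E ∩ F).card = m :=
    ⟨_, Finset.card_pos.2 ⟨γ, hγ⟩, E, F, hE, hF, ha, hb, rfl⟩
  obtain ⟨m1, E', F', hE', hF', ha', hb', hm⟩ := Nat.find_spec hex
  have hmin := fun k => Nat.find_min hex (m := k)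
  generalize Nat.find hex = m at *
  have h2 : 2 ≤ m := by
    have := hno E' F' hE' hF' ha' hb'
    omega
  have hMP : MinPair G m α β E' F' := by
    refine ⟨hE', hF', ha', hb', hm, ?_⟩
    intro E₁ F₁ h1 h2 h3 h4 h5
    by_contra h6
    exact hmin _ h5 ⟨Finset.card_pos.2 (Finset.nonempty_iff_ne_empty.2 h6), E₁, F₁, h1, h2, h3, h4,
      rfl⟩
  by_contra hcon
  have hQ : ∀ {α β : Ω}, NoSmall G m α β := by
    intro α β E F h e he s hs hs1
    by_contra hsm
    push Not at hsm
    exact hcon (concl_of_small hprim h2 h he hs hs1 hsm)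
  exact main0 hb7 h2 hab hQ hQ hMP

end SaxlAux

theorem statement_6 {Ω : Type*} [Fintype Ω] [DecidableEq Ω]
    (G : Subgroup (Equiv.Perm Ω)) (hprim : IsPrimitivePerm G)
    (hb2 : 2 ≤ baseSize G) (hb7 : baseSize G ≤ 7)
    (hcnc : ∀ α β : Ω, α ≠ β → ∃ γ : Ω, γ ≠ α ∧ γ ≠ β ∧
      ∃ Eα Eβ : Set Ω, IsSaxlEdge G Eα ∧ IsSaxlEdge G Eβ ∧
        α ∈ Eα ∧ γ ∈ Eα ∧ β ∈ Eβ ∧ γ ∈ Eβ) :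
    (G = ⊤ ∧ 4 ≤ Fintype.card Ω) ∨
    (G = alternatingGroup Ω ∧ 6 ≤ Fintype.card Ω) ∨
    (∀ α β : Ω, α ≠ β → ∃ Eα Eβ : Set Ω, IsSaxlEdge G Eα ∧ IsSaxlEdge G Eβ ∧
      α ∈ Eα ∧ β ∈ Eβ ∧ (Eα ∩ Eβ).ncard = 1) := by  classical
  by_cases hc : ∀ α β : Ω, α ≠ β → ∃ Eα Eβ : Set Ω, IsSaxlEdge G Eα ∧ IsSaxlEdge G Eβ ∧
      α ∈ Eα ∧ β ∈ Eβ ∧ (Eα ∩ Eβ).ncard = 1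
  · exact Or.inr (Or.inr hc)
  push Not at hc
  obtain ⟨α, β, hab, hno⟩ := hc
  obtain ⟨γ, -, -, E, F, hE, hF, ha, hg, hb, hg'⟩ := hcnc α β hab
  have key := SaxlAux.final (G := G) hprim hb7 (γ := γ) hab (E := E.toFinset) (F := F.toFinset)
    (by simpa [SaxlAux.Edge] using hE) (by simpa [SaxlAux.Edge] using hF) (by simpa using ha)
    (by simpa using hb) (by simpa using ⟨hg, hg'⟩) (by
      intro E' F' h1 h2 h3 h4 h5
      refine hno (E' : Set Ω) (F' : Set Ω) h1 h2 (by simpa using h3) (by simpa using h4) ?_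
      rw [← Finset.coe_inter, Set.ncard_coe_finset]
      exact h5)
  rcases key with h | h
  · exact Or.inl h
  · exact Or.inr (Or.inl h)
end

section
/- Let V be a finite-dimensional vector space over a finite field F_q, and let G ≤ Sym(V) be a primitive permutation group with b(G) ≥ 2 that contains every translation v ↦ v + w (w ∈ V), and whose stabiliser of the zero vector consists of invertible F_q-semilinear transformations of V. Suppose that for all distinct v, w ∈ V there exist a point u ∉ {v, w} and edges E_v, E_w of the Saxl hypergraph Σ(G) with v, u ∈ E_v and w, u ∈ E_w. Then one of the following holds: (a) G = Sym(V) with |V| ≥ 4; (b) G = Alt(V) with |V| ≥ 6; or (c) for all distinct v, w ∈ V there exist edges E_v, E_w of Σ(G) with v ∈ E_v, w ∈ E_w and |E_v ∩ E_w| = 1. -/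
theorem base_of_closure {V : Type*} [AddCommGroup V] {G : Subgroup (Equiv.Perm V)}
    (hadd : ∀ g ∈ G, g 0 = 0 → ∀ x y : V, g (x + y) = g x + g y)
    {E E' : Set V} (h0 : (0 : V) ∈ E') (hE : IsBase G E)
    (hsub : ∀ x ∈ E, x ∈ AddSubgroup.closure E') : IsBase G E' := by
  intro g hg hfix
  have g0 := hfix 0 h0
  have ha := hadd g hg g0
  apply hE g hg
  intro b hb
  refine AddSubgroup.closure_induction (p := fun x _ => g x = x) ?_ g0 ?_ ?_ (hsub b hb)
  · intro x hx; exact hfix x hx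
  · intro x y _ _ hx hy; rw [ha, hx, hy]
  · intro x _ hx
    have := ha x (-x)
    rw [add_neg_cancel, g0, hx] at this
    exact (neg_eq_of_add_eq_zero_right this.symm).symm

theorem baseSize_le {V : Type*} {G : Subgroup (Equiv.Perm V)}
    {E : Set V} (hE : IsBase G E) : baseSize G ≤ E.ncard :=
  Nat.sInf_le ⟨E, hE, rfl⟩

theorem edge_indep {V : Type*} [AddCommGroup V] [Finite V] {G : Subgroup (Equiv.Perm V)}
    (hadd : ∀ g ∈ G, g 0 = 0 → ∀ x y : V, g (x + y) = g x + g y)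
    {E : Set V} (hE : IsSaxlEdge G E) (h0 : (0 : V) ∈ E) {e : V} (he : e ∈ E) (hne : e ≠ 0) :
    e ∉ AddSubgroup.closure (E \ {e}) := by
  intro hc
  have hb : IsBase G (E \ {e}) := by
    refine base_of_closure hadd ⟨h0, fun h => hne h.symm⟩ hE.1 ?_
    intro x hx
    by_cases hxe : x = e
    · rw [hxe]; exact hc
    · exact AddSubgroup.subset_closure ⟨hx, hxe⟩
  have h1 := baseSize_le hb
  have h2 := Set.ncard_sdiff_singleton_lt_of_mem he (Set.toFinite E)
  have h3 := hE.2
  omega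

theorem edge_replace {V : Type*} [AddCommGroup V] [Finite V] {G : Subgroup (Equiv.Perm V)}
    (hadd : ∀ g ∈ G, g 0 = 0 → ∀ x y : V, g (x + y) = g x + g y)
    {E : Set V} (hE : IsSaxlEdge G E) (h0 : (0 : V) ∈ E) {x h : V} (hx : x ∈ E) (hne : x ≠ 0)
    (hh : h ∈ AddSubgroup.closure (E \ {x})) :
    IsSaxlEdge G (insert (x + h) (E \ {x})) := by
  have hb : IsBase G (insert (x + h) (E \ {x})) := by
    refine base_of_closure hadd (Or.inr ⟨h0, fun h => hne h.symm⟩) hE.1 ?_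
    intro y hy
    by_cases hyx : y = x
    · subst hyx
      have h1 : y + h ∈ AddSubgroup.closure (insert (y + h) (E \ {y})) :=
        AddSubgroup.subset_closure (Or.inl rfl)
      have h2 : h ∈ AddSubgroup.closure (insert (y + h) (E \ {y})) :=
        AddSubgroup.closure_mono (Set.subset_insert _ _) hh
      simpa using AddSubgroup.sub_mem _ h1 h2
    · exact AddSubgroup.subset_closure (Or.inr ⟨hy, hyx⟩)
  refine ⟨hb, le_antisymm ?_ (baseSize_le hb)⟩
  have h1 := Set.ncard_insert_le (x + h) (E \ {x})
  have h2 := Set.ncard_sdiff_singleton_add_one hx (Set.toFinite E)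
  have h3 := hE.2
  omega

theorem edge_image {V : Type*} {G : Subgroup (Equiv.Perm V)}
    {E : Set V} (hE : IsSaxlEdge G E) {p : Equiv.Perm V} (hp : p ∈ G) :
    IsSaxlEdge G (p '' E) := by
  constructor
  · intro g hg hfix
    have h1 : p⁻¹ * g * p = 1 := by
      apply hE.1 _ (G.mul_mem (G.mul_mem (G.inv_mem hp) hg) hp)
      intro b hb
      have := hfix (p b) ⟨b, hb, rfl⟩
      simp [Equiv.Perm.mul_apply, this]
    have h2 : g * p = p := by
      have := congrArg (fun z => p * z) h1
      simpa [mul_assoc] using this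
    simpa using h2
  · rw [Set.ncard_image_of_injective _ p.injective, hE.2]

theorem edge_translate {V : Type*} [AddCommGroup V] {G : Subgroup (Equiv.Perm V)}
    (htransl : ∀ w : V, (Equiv.addRight w : Equiv.Perm V) ∈ G)
    {E : Set V} (hE : IsSaxlEdge G E) (t : V) :
    IsSaxlEdge G ((fun x => x + t) '' E) := by
  simpa using edge_image hE (htransl t)

theorem main_step {V : Type*} [AddCommGroup V] [Finite V] {G : Subgroup (Equiv.Perm V)}
    (hadd : ∀ g ∈ G, g 0 = 0 → ∀ x y : V, g (x + y) = g x + g y)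
    {v w : V} (hv : v ≠ 0) (hw : w ≠ 0) (hvw : v ≠ w)
    {Ev₀ Ew₀ : Set V} (hEv₀ : IsSaxlEdge G Ev₀) (hEw₀ : IsSaxlEdge G Ew₀)
    (hv₀ : (0 : V) ∈ Ev₀) (hvv₀ : v ∈ Ev₀) (hw₀ : (0 : V) ∈ Ew₀) (hww₀ : w ∈ Ew₀) :
    (∃ Ev Ew : Set V, IsSaxlEdge G Ev ∧ IsSaxlEdge G Ew ∧
      v ∈ Ev ∧ w ∈ Ew ∧ (Ev ∩ Ew).ncard = 1) ∨
    (v + v = 0 ∧ IsSaxlEdge G {0, v, w}) := by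
  -- arrange that `v` is not in `Ew`
  obtain ⟨Ew, hEw, hw0, hww, hvEw⟩ : ∃ Ew : Set V, IsSaxlEdge G Ew ∧ (0 : V) ∈ Ew ∧ w ∈ Ew ∧
      v ∉ Ew := by
    by_cases hmem : v ∈ Ew₀
    · have hwm : w ∈ Ew₀ \ {v} := ⟨hww₀, fun h => hvw h.symm⟩
      refine ⟨insert (v + w) (Ew₀ \ {v}), edge_replace hadd hEw₀ hw₀ hmem hv
        (AddSubgroup.subset_closure hwm), Or.inr ⟨hw₀, fun h => hv h.symm⟩, Or.inr hwm, ?_⟩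
      rintro (h | h)
      · exact hw (by simpa using h)
      · exact h.2 rfl
    · exact ⟨Ew₀, hEw₀, hw₀, hww₀, hmem⟩
  -- choose `Ev` with minimal intersection
  obtain ⟨Ev, ⟨hEv, hv0, hvv⟩, hmin⟩ := Set.exists_min_image
    {E : Set V | IsSaxlEdge G E ∧ (0 : V) ∈ E ∧ v ∈ E} (fun E => (E ∩ Ew).ncard)
    (Set.toFinite _) ⟨Ev₀, hEv₀, hv₀, hvv₀⟩
  by_cases hint : Ev ∩ Ew ⊆ {0}
  · left
    refine ⟨Ev, Ew, hEv, hEw, hvv, hww, ?_⟩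
    have : Ev ∩ Ew = {0} := Set.Subset.antisymm hint (by simp [hv0, hw0])
    rw [this]; simp
  · right
    obtain ⟨x, ⟨hxv, hxw⟩, hx0⟩ := Set.not_subset.1 hint
    have hx0 : x ≠ 0 := hx0
    have hxnv : x ≠ v := fun h => hvEw (h ▸ hxw)
    have hxind := edge_indep hadd hEv hv0 hxv hx0
    -- all translates lie in `Ew`
    have key : ∀ h ∈ AddSubgroup.closure (Ev \ {x}), x + h ∈ Ew := by
      intro h hh
      by_contra hnot
      have hle := hmin (insert (x + h) (Ev \ {x})) ⟨edge_replace hadd hEv hv0 hxv hx0 hh,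
        Or.inr ⟨hv0, fun h => hx0 h.symm⟩, Or.inr ⟨hvv, fun h => hxnv h.symm⟩⟩
      have hss : insert (x + h) (Ev \ {x}) ∩ Ew ⊂ Ev ∩ Ew := by
        refine ⟨?_, fun hc => ?_⟩
        · rintro y ⟨rfl | hy, hyw⟩
          · exact absurd hyw hnot
          · exact ⟨hy.1, hyw⟩
        · rcases (hc ⟨hxv, hxw⟩).1 with h1 | h1
          · rw [← h1] at hnot; exact hnot hxw
          · exact h1.2 rfl
      have := Set.ncard_lt_ncard hss (Set.toFinite _)
      omega
    have hvm : v ∈ AddSubgroup.closure (Ev \ {x}) :=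
      AddSubgroup.subset_closure ⟨hvv, fun h => hxnv h.symm⟩
    have hxh0 : ∀ h ∈ AddSubgroup.closure (Ev \ {x}), x + h ≠ 0 := by
      intro h hh h0
      apply hxind
      have hm := AddSubgroup.neg_mem _ hh
      rwa [← eq_neg_of_add_eq_zero_left h0] at hm
    have hEveq : Ev = {0, v, x} := by
      refine Set.Subset.antisymm ?_ ?_
      · intro k hk
        by_contra hkn
        simp only [Set.mem_insert_iff, Set.mem_singleton_iff, not_or] at hkn
        obtain ⟨hk0, hkv, hkx⟩ := hkn
        have hkm : k ∈ AddSubgroup.closure (Ev \ {x}) := AddSubgroup.subset_closure ⟨hk, hkx⟩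
        have hvk := AddSubgroup.sub_mem _ hvm hkm
        have e1 : x + v ∈ Ew := key _ hvm
        have e2 : x + -k ∈ Ew := key _ (AddSubgroup.neg_mem _ hkm)
        have e3 : x + (v - k) ∈ Ew := key _ hvk
        apply edge_indep hadd hEw hw0 e3 (hxh0 _ hvk)
        have f0 : x ∈ AddSubgroup.closure (Ew \ {x + (v - k)}) := by
          refine AddSubgroup.subset_closure ⟨hxw, fun h => ?_⟩
          have h : x = x + (v - k) := h
          have h' : v - k = 0 := by simpa using h
          exact hkv (sub_eq_zero.1 h').symm
        have f1 : x + v ∈ AddSubgroup.closure (Ew \ {x + (v - k)}) := by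
          refine AddSubgroup.subset_closure ⟨e1, fun h => ?_⟩
          have h : x + v = x + (v - k) := h
          have h' := add_left_cancel h
          exact hk0 (sub_eq_self.1 h'.symm)
        have f2 : x + -k ∈ AddSubgroup.closure (Ew \ {x + (v - k)}) := by
          refine AddSubgroup.subset_closure ⟨e2, fun h => ?_⟩
          have h : x + -k = x + (v - k) := h
          have h' := add_left_cancel h
          rw [sub_eq_add_neg] at h'
          exact hv (by simpa using h')
        have := AddSubgroup.sub_mem _ (AddSubgroup.add_mem _ f1 f2) f0
        have he : x + v + (x + -k) - x = x + (v - k) := by abel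
        rwa [he] at this
      · rintro y (rfl | rfl | rfl) <;> assumption
    have hcard3 : Ew.ncard = 3 := by
      rw [hEw.2, ← hEv.2, hEveq]
      exact Set.ncard_eq_three.2 ⟨0, v, x, hv.symm, hx0.symm, hxnv.symm, rfl⟩
    have e1 : x + v ∈ Ew := key _ hvm
    have hEweq : Ew = {0, x, x + v} := by
      symm
      apply Set.eq_of_subset_of_ncard_le _ _ (Set.toFinite _)
      · rintro y (rfl | rfl | rfl) <;> assumption
      · rw [hcard3]
        exact (Set.ncard_eq_three.2 ⟨0, x, x + v, hx0.symm, (hxh0 _ hvm).symm,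
          by simpa using hv, rfl⟩).ge
    have e2 : x + -v ∈ Ew := key _ (AddSubgroup.neg_mem _ hvm)
    constructor
    · rw [hEweq] at e2
      rcases e2 with h | h | h
      · exact absurd h (hxh0 _ (AddSubgroup.neg_mem _ hvm))
      · exact absurd (by simpa using h) hv
      · have h : x + -v = x + v := h
        have h' := add_left_cancel h
        exact (neg_eq_iff_add_eq_zero.1 h')
    · rw [hEweq] at hww
      rcases hww with h | h | h
      · exact absurd h hw
      · rw [h, ← hEveq]; exact hEv
      · have h : w = x + v := h
        have := edge_replace hadd hEv hv0 hxv hx0 hvm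
        convert this using 1
        rw [hEveq, h]
        ext y
        simp only [Set.mem_insert_iff, Set.mem_singleton_iff, Set.mem_sdiff]
        constructor
        · rintro (rfl | rfl | rfl)
          · exact Or.inr ⟨Or.inl rfl, hx0.symm⟩
          · exact Or.inr ⟨Or.inr (Or.inl rfl), hxnv.symm⟩
          · exact Or.inl rfl
        · tauto

theorem top_of_card {V : Type*} [Fintype V] [DecidableEq V] (G : Subgroup (Equiv.Perm V))
    (h : Fintype.card V < baseSize G + 2) : G = ⊤ := by
  rw [eq_top_iff, ← Equiv.Perm.closure_isSwap, Subgroup.closure_le]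
  rintro f ⟨y, z, hyz, rfl⟩
  have hcard : ({y, z} : Set V)ᶜ.ncard + 2 = Fintype.card V := by
    have := Set.ncard_add_ncard_compl ({y, z} : Set V)
    rw [Set.ncard_pair hyz, Nat.card_eq_fintype_card] at this
    omega
  have hnb : ¬ IsBase G ({y, z} : Set V)ᶜ := fun hb => by
    have := baseSize_le hb
    omega
  simp only [IsBase, not_forall] at hnb
  obtain ⟨g, hg, hfix, hne⟩ := hnb
  have hfix' : ∀ b, b ≠ y → b ≠ z → g b = b := fun b h1 h2 => hfix b (by simp [h1, h2])
  have hgy : g y = y ∨ g y = z := by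
    by_contra hc
    push Not at hc
    exact hc.1 (g.injective (hfix' _ hc.1 hc.2))
  have hgz : g z = y ∨ g z = z := by
    by_contra hc
    push Not at hc
    exact hc.2 (g.injective (hfix' _ hc.1 hc.2))
  have : g = Equiv.swap y z := by
    rcases hgy with h1 | h1
    · have h2 : g z = z := hgz.resolve_left (fun h => hyz (g.injective (h1.trans h.symm)))
      exfalso
      apply hne
      ext b
      by_cases hb1 : b = y
      · rw [hb1, h1]; rfl
      by_cases hb2 : b = z
      · rw [hb2, h2]; rfl
      exact hfix' b hb1 hb2
    · have h2 : g z = y := hgz.resolve_right (fun h => hyz (g.injective (h1.trans h.symm)))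
      ext b
      by_cases hb1 : b = y
      · rw [hb1, h1, Equiv.swap_apply_left]
      by_cases hb2 : b = z
      · rw [hb2, h2, Equiv.swap_apply_right]
      rw [hfix' b hb1 hb2, Equiv.swap_apply_of_ne_of_ne hb1 hb2]
  show Equiv.swap y z ∈ G
  rw [← this]; exact hg

theorem char_two_step {V : Type*} [AddCommGroup V] [Fintype V] [DecidableEq V]
    {G : Subgroup (Equiv.Perm V)} (hprim : IsPrimitivePerm G)
    (htransl : ∀ w : V, (Equiv.addRight w : Equiv.Perm V) ∈ G)
    (hadd : ∀ g ∈ G, g 0 = 0 → ∀ x y : V, g (x + y) = g x + g y)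
    (h2 : ∀ x : V, x + x = 0) {a c : V} (ha : a ≠ 0) (hc : c ≠ 0) (hac : a ≠ c)
    (hE : IsSaxlEdge G {0, a, c}) :
    (G = ⊤ ∧ 4 ≤ Fintype.card V) ∨
    (∃ Ev Ew : Set V, IsSaxlEdge G Ev ∧ IsSaxlEdge G Ew ∧
      0 ∈ Ev ∧ a ∈ Ew ∧ (Ev ∩ Ew).ncard = 1) := by
  have hneg : ∀ x : V, -x = x := fun x => neg_eq_of_add_eq_zero_left (h2 x)
  have hb3 : baseSize G = 3 := by
    rw [← hE.2]
    exact Set.ncard_eq_three.2 ⟨0, a, c, ha.symm, hc.symm, hac, rfl⟩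
  -- the plane
  obtain ⟨P, hP⟩ : ∃ P : AddSubgroup V, ∀ x, x ∈ P ↔ x = 0 ∨ x = a ∨ x = c ∨ x = a + c := by
    refine ⟨⟨⟨⟨{x | x = 0 ∨ x = a ∨ x = c ∨ x = a + c}, ?_⟩, Or.inl rfl⟩, ?_⟩, fun x => Iff.rfl⟩
    · have k1 : a + (a + c) = c := by rw [← add_assoc, h2, zero_add]
      have k2 : c + (a + c) = a := by rw [add_left_comm, h2, add_zero]
      have k3 : a + c + a = c := by rw [add_comm, k1]
      have kk : c + a = a + c := add_comm c a
      have k4 : a + c + c = a := by rw [add_comm, k2]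
      rintro x y (h | h | h | h) (h' | h' | h' | h') <;> rw [h, h'] <;>
        simp [h2, k1, k2, k3, k4, kk]
    · intro x hx
      simpa [hneg] using hx
  have hPa : a ∈ P := (hP a).2 (by simp)
  have hPc : c ∈ P := (hP c).2 (by simp)
  by_cases hall : ∀ E : Set V, IsSaxlEdge G E → (0 : V) ∈ E → ∀ x ∈ E, x ∈ P
  · left
    have hsub : ∀ g ∈ G, ∀ p ∈ P, g p ∈ P → ∀ x ∈ P, g x ∈ P := by
      intro g hg p hp hgp x hx
      let h : Equiv.Perm V := Equiv.addRight (-(g p)) * g * Equiv.addRight p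
      have hh : h ∈ G := G.mul_mem (G.mul_mem (htransl _) hg) (htransl _)
      have hdef : ∀ y, h y = g (y + p) + -(g p) := fun y => rfl
      have h0 : h 0 = 0 := by rw [hdef]; simp
      have hha := hadd h hh h0
      have hE' := hall _ (edge_image hE hh) ⟨0, by simp, h0⟩
      have q1 : h a ∈ P := hE' _ ⟨a, by simp, rfl⟩
      have q2 : h c ∈ P := hE' _ ⟨c, by simp, rfl⟩
      have q : ∀ y ∈ P, h y ∈ P := by
        intro y hy
        rcases (hP y).1 hy with rfl | rfl | rfl | rfl
        · rw [h0]; exact P.zero_mem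
        · exact q1
        · exact q2
        · rw [hha]; exact P.add_mem q1 q2
      have := P.add_mem (q (x - p) (P.sub_mem hx hp)) hgp
      rw [hdef] at this
      simpa using this
    have hblock := hprim.2 (P : Set V) (by
      intro g hg
      by_cases hd : Disjoint (g '' (P : Set V)) P
      · exact Or.inr hd
      · left
        obtain ⟨q, ⟨p, hp, rfl⟩, hq⟩ := Set.not_disjoint_iff.1 hd
        apply Set.eq_of_subset_of_ncard_le _ _ (Set.toFinite _)
        · rintro _ ⟨x, hx, rfl⟩
          exact hsub g hg p hp hq x hx
        · rw [Set.ncard_image_of_injective _ g.injective])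
    rcases hblock with hs | hu
    · exact absurd (hs hPa P.zero_mem) ha
    · have hcard : Fintype.card V = 4 := by
        have huniv : (Finset.univ : Finset V) = {0, a, c, a + c} := by
          ext x
          have : x ∈ (P : Set V) := by rw [hu]; trivial
          simpa using (hP x).1 this
        rw [← Finset.card_univ, huniv]
        have n1 : a + c ≠ 0 := fun h => hac (by rw [← hneg c]; exact eq_neg_of_add_eq_zero_left h)
        have n2 : a ≠ a + c := by simpa using hc
        have n3 : c ≠ a + c := by simpa using ha
        rw [Finset.card_insert_of_notMem, Finset.card_insert_of_notMem,
          Finset.card_insert_of_notMem, Finset.card_singleton]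
        · simpa using ha
        · simpa using ⟨hac, hc⟩
        · simp [ha.symm, hc.symm, n1.symm]
      exact ⟨top_of_card G (by omega), by omega⟩
  · right
    push Not at hall
    obtain ⟨E, hEe, hE0, s, hsE, hsP⟩ := hall
    have hs0 : s ≠ 0 := fun h => hsP (h ▸ P.zero_mem)
    -- edge meeting `P` only in `0`
    obtain ⟨E', hE', hE'0, hE'P⟩ : ∃ E' : Set V, IsSaxlEdge G E' ∧ (0 : V) ∈ E' ∧
        ∀ x ∈ E', x ∈ P → x = 0 := by
      by_cases hgood : ∀ x ∈ E, x ∈ P → x = 0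
      · exact ⟨E, hEe, hE0, hgood⟩
      push Not at hgood
      obtain ⟨t, htE, htP, ht0⟩ := hgood
      have hst : s ≠ t := fun h => hsP (h ▸ htP)
      have hEeq : ({0, s, t} : Set V) = E := by
        apply Set.eq_of_subset_of_ncard_le _ _ (Set.toFinite _)
        · rintro y (rfl | rfl | rfl) <;> assumption
        · rw [hEe.2, hb3]
          exact (Set.ncard_eq_three.2 ⟨0, s, t, hs0.symm, ht0.symm, hst, rfl⟩).ge
      refine ⟨insert (t + s) (E \ {t}), edge_replace hadd hEe hE0 htE ht0
        (AddSubgroup.subset_closure ⟨hsE, hst⟩), Or.inr ⟨hE0, ht0.symm⟩, ?_⟩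
      rintro x (rfl | ⟨hxE, hxt⟩) hxP
      · exact absurd (by simpa using P.sub_mem hxP htP) hsP
      · rw [← hEeq] at hxE
        rcases hxE with h | h | h
        · exact h
        · exact absurd (h ▸ hxP) hsP
        · exact absurd h hxt
    refine ⟨{0, a, c}, (fun x => x + a) '' E', hE, edge_translate htransl hE' a, by simp,
      ⟨0, hE'0, by simp⟩, ?_⟩
    have : ({0, a, c} : Set V) ∩ (fun x => x + a) '' E' = {a} := by
      ext y
      constructor
      · rintro ⟨hy, x, hx, rfl⟩
        have hyP : x + a ∈ P := by
          rw [hP]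
          rcases hy with h | h | h
          · exact Or.inl h
          · exact Or.inr (Or.inl h)
          · exact Or.inr (Or.inr (Or.inl h))
        have := hE'P x hx (by simpa using P.sub_mem hyP hPa)
        simp [this]
      · rintro rfl
        exact ⟨by simp, 0, hE'0, by simp⟩
    rw [this]; simp

theorem statement_7 {F V : Type*} [Field F] [Fintype F]
    [AddCommGroup V] [Module F V] [FiniteDimensional F V] [Fintype V] [DecidableEq V]
    (G : Subgroup (Equiv.Perm V)) (hprim : IsPrimitivePerm G) (hb : 2 ≤ baseSize G)
    -- `G` contains every translation `v ↦ v + w`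
    (htransl : ∀ w : V, (Equiv.addRight w : Equiv.Perm V) ∈ G)
    -- the stabiliser of `0` consists of invertible `F`-semilinear maps
    (hstab : ∀ g ∈ G, g 0 = 0 →
      ∃ σ : F ≃+* F, (∀ x y : V, g (x + y) = g x + g y) ∧
        ∀ (c : F) (v : V), g (c • v) = σ c • g v)
    (hcnc : ∀ v w : V, v ≠ w → ∃ u : V, u ≠ v ∧ u ≠ w ∧
      ∃ Ev Ew : Set V, IsSaxlEdge G Ev ∧ IsSaxlEdge G Ew ∧
        v ∈ Ev ∧ u ∈ Ev ∧ w ∈ Ew ∧ u ∈ Ew) :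
    (G = ⊤ ∧ 4 ≤ Fintype.card V) ∨
    (G = alternatingGroup V ∧ 6 ≤ Fintype.card V) ∨
    (∀ v w : V, v ≠ w → ∃ Ev Ew : Set V, IsSaxlEdge G Ev ∧ IsSaxlEdge G Ew ∧
      v ∈ Ev ∧ w ∈ Ew ∧ (Ev ∩ Ew).ncard = 1) := by
  have hadd : ∀ g ∈ G, g 0 = 0 → ∀ x y : V, g (x + y) = g x + g y := by
    intro g hg h0
    obtain ⟨_, h, _⟩ := hstab g hg h0
    exact h
  have back : ∀ (t v w : V), (∃ Ev Ew : Set V, IsSaxlEdge G Ev ∧ IsSaxlEdge G Ew ∧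
      v - t ∈ Ev ∧ w - t ∈ Ew ∧ (Ev ∩ Ew).ncard = 1) →
      ∃ Ev Ew : Set V, IsSaxlEdge G Ev ∧ IsSaxlEdge G Ew ∧
      v ∈ Ev ∧ w ∈ Ew ∧ (Ev ∩ Ew).ncard = 1 := by
    rintro t v w ⟨Ev, Ew, h1, h2, h3, h4, h5⟩
    refine ⟨_, _, edge_translate htransl h1 t, edge_translate htransl h2 t,
      ⟨_, h3, by simp⟩, ⟨_, h4, by simp⟩, ?_⟩
    rw [← Set.image_inter (add_left_injective t),
      Set.ncard_image_of_injective _ (add_left_injective t), h5]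
  by_cases htop : G = ⊤ ∧ 4 ≤ Fintype.card V
  · exact Or.inl htop
  right; right
  intro v w hvw
  obtain ⟨u, huv, huw, Ev, Ew, hEv, hEw, hvEv, huEv, hwEw, huEw⟩ := hcnc v w hvw
  have hsv : v - u ≠ 0 := sub_ne_zero.2 huv.symm
  have hsw : w - u ≠ 0 := sub_ne_zero.2 huw.symm
  rcases main_step hadd (v := v - u) (w := w - u) hsv hsw (fun h => hvw (sub_left_injective h))
    (edge_translate htransl hEv (-u)) (edge_translate htransl hEw (-u))
    ⟨u, huEv, by simp⟩ ⟨v, hvEv, by simp [sub_eq_add_neg]⟩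
    ⟨u, huEw, by simp⟩ ⟨w, hwEw, by simp [sub_eq_add_neg]⟩ with h | ⟨hd, hedge⟩
  · exact back u v w h
  · have h2F : (2 : F) = 0 := by
      have : (2 : F) • (v - u) = 0 := by rw [two_smul, hd]
      exact (smul_eq_zero.1 this).resolve_right hsv
    have h2 : ∀ x : V, x + x = 0 := fun x => by rw [← two_smul F, h2F, zero_smul]
    have hE : IsSaxlEdge G {0, w - v, u - v} := by
      have := edge_translate htransl hedge (u - v)
      convert this using 1
      rw [Set.image_insert_eq, Set.image_insert_eq, Set.image_singleton]
      have k1 : v - u + (u - v) = 0 := by abel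
      have k2 : w - u + (u - v) = w - v := by abel
      rw [k1, k2, zero_add]
      ext y
      simp only [Set.mem_insert_iff, Set.mem_singleton_iff]
      tauto
    rcases char_two_step hprim htransl hadd h2 (sub_ne_zero.2 hvw.symm) (sub_ne_zero.2 huv)
      (fun h => huw (sub_left_injective h).symm) hE with h | h
    · exact absurd h htop
    · apply back v v w
      simpa using h
end

section
/- Let q be an even prime power, k ≥ 2 an integer, and n = q^k − 1. Let V = {v ∈ F_q^n : v_1 + ⋯ + v_n = 0}, and let G ≤ Sym(V) be the group generated by all translations v ↦ v + w (w ∈ V) together with the permutations of V induced by Sym(n) permuting the n coordinates. Then the fourth gossip number of the Saxl hypergraph Σ(G) is g_4 = 0; indeed, the four distinct points v = (1, 1, 0, 0, …, 0), v' = (1, 0, 1, 0, …, 0), v + v', and 0 of V have no common neighbour in Σ(G). -/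
/-- `α` and `β` are neighbours in the Saxl hypergraph `Σ(G)`. -/
def SaxlAdj {Ω : Type*} (G : Subgroup (Equiv.Perm Ω)) (α β : Ω) : Prop :=
  α ≠ β ∧ ∃ E : Set Ω, IsSaxlEdge G E ∧ α ∈ E ∧ β ∈ E

/-- The `m`-th gossip number of the Saxl hypergraph `Σ(G)`. -/
noncomputable def saxlGossip {Ω : Type*} (G : Subgroup (Equiv.Perm Ω)) (m : ℕ) : ℕ :=
  if 1 ≤ m ∧ m ≤ Nat.card Ω then
    sInf {c | ∃ S : Set Ω, S.ncard = m ∧ c = {γ | ∀ s ∈ S, SaxlAdj G γ s}.ncard}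
  else 0

/-- The zero-sum subgroup of `F^n` (the deleted permutation module). -/
def zeroSum (F : Type*) [Field F] (n : ℕ) : AddSubgroup (Fin n → F) where
  carrier := {v | ∑ i, v i = 0}
  add_mem' := by
    intro a b ha hb
    simp only [Set.mem_setOf_eq] at ha hb ⊢
    simp [Finset.sum_add_distrib, ha, hb]
  zero_mem' := by simp
  neg_mem' := by
    intro a ha
    simp only [Set.mem_setOf_eq] at ha ⊢
    simp [Finset.sum_neg_distrib, ha]

/-- The permutation of the zero-sum module induced by a permutation `π` of
the `n` coordinates. -/
def coordPerm {F : Type*} [Field F] {n : ℕ} (π : Equiv.Perm (Fin n)) :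
    Equiv.Perm (zeroSum F n) :=
  Equiv.Perm.subtypePerm (Equiv.arrowCongr π (Equiv.refl F)) (by
    intro x
    have h : ∑ i, x (π.symm i) = ∑ i, x i := Equiv.sum_comp π.symm x
    have hmem : ∀ y : Fin n → F, (y ∈ zeroSum F n ↔ ∑ i, y i = 0) := fun y => Iff.rfl
    rw [hmem, hmem]
    have happ : ∀ i, (Equiv.arrowCongr π (Equiv.refl F) x) i = x (π.symm i) := by
      intro i; simp [Equiv.arrowCongr_apply]
    rw [Finset.sum_congr rfl (fun i _ => happ i), h])

namespace Saxl11
open Finset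

theorem coordPerm_apply {F : Type*} [Field F] {n : ℕ} (π : Equiv.Perm (Fin n))
    (x : zeroSum F n) (i : Fin n) :
    ((coordPerm π x : zeroSum F n) : Fin n → F) i = (x : Fin n → F) (π.symm i) := rfl

/-- The affine group in the statement. -/
def grp (F : Type*) [Field F] (n : ℕ) : Subgroup (Equiv.Perm (zeroSum F n)) :=
  Subgroup.closure
      ({e | ∃ w : (zeroSum F n), e = Equiv.addRight w} ∪
       {e | ∃ π : Equiv.Perm (Fin n), e = coordPerm π})

theorem grp_form {F : Type*} [Field F] {n : ℕ} (g : Equiv.Perm (zeroSum F n))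
    (hg : g ∈ grp F n) : ∃ (π : Equiv.Perm (Fin n)) (w : Fin n → F),
      ∀ x : zeroSum F n, ∀ i, (g x : Fin n → F) i = (x : Fin n → F) (π i) + w i := by
  unfold grp at hg
  induction hg using Subgroup.closure_induction with
  | mem x hx =>
    rcases hx with ⟨w, rfl⟩ | ⟨π, rfl⟩
    · exact ⟨1, w, fun x i => rfl⟩
    · exact ⟨π.symm, 0, fun x i => by simp [coordPerm_apply]⟩
  | one => exact ⟨1, 0, fun x i => by simp⟩
  | mul g h _ _ hg hh =>
    obtain ⟨π, w, hπ⟩ := hg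
    obtain ⟨σ, v, hσ⟩ := hh
    refine ⟨σ * π, fun i => v (π i) + w i, fun x i => ?_⟩
    rw [Equiv.Perm.mul_apply, hπ, hσ]
    simp [add_assoc]
  | inv g _ hg =>
    obtain ⟨π, w, hπ⟩ := hg
    refine ⟨π.symm, fun i => - w (π.symm i), fun x i => ?_⟩
    have := hπ (g⁻¹ x) (π.symm i)
    have hgg : g (g⁻¹ x) = x := Equiv.apply_symm_apply g x
    rw [hgg, Equiv.apply_symm_apply] at this
    rw [this]; ring

theorem sum_coord {F ι M : Type*} [Fintype F] [Fintype ι] [DecidableEq ι] [CommRing M]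
    (j : ι) (φ : F → M) :
    ∑ x : ι → F, φ (x j) = (Fintype.card F : M) ^ (Fintype.card ι - 1) * ∑ c, φ c := by
  rw [← (Equiv.funSplitAt j F).symm.sum_comp, Fintype.sum_prod_type]
  simp [Equiv.funSplitAt, Equiv.piSplitAt, ← Finset.mul_sum, Fintype.card_subtype_compl]

theorem baseSize_le {F : Type*} [Field F] [Fintype F] (k n : ℕ) (hk : 2 ≤ k)
    (hn : n = Fintype.card F ^ k - 1) : baseSize (grp F n) ≤ k + 1 := by
  classical
  have hc : Fintype.card (Fin n) = Fintype.card {x : Fin k → F // x ≠ 0} := by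
    rw [Fintype.card_subtype_compl]; simp [hn]
  let e := Fintype.equivOfCardEq hc
  let v : Fin k → zeroSum F n := fun j => ⟨fun i => (e i).1 j, by
    change ∑ i, (e i).1 j = 0
    rw [e.sum_comp (fun x => x.1 j)]
    have h1 := sum_coord (F := F) (M := F) j id
    have h2 : ∑ x : Fin k → F, x j = ∑ x : {x : Fin k → F // x ≠ 0}, x.1 j := by
      rw [← Finset.sum_subtype (univ.filter (fun x : Fin k → F => x ≠ 0)) (by simp) (fun x => x j)]
      symm
      apply Finset.sum_filter_of_ne
      intro x _ h h0
      simp [h0] at h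
    rw [← h2]
    simp only [id] at h1
    rw [h1]
    have : Fintype.card (Fin k) - 1 ≠ 0 := by simp; omega
    rw [FiniteField.cast_card_eq_zero, zero_pow this, zero_mul]⟩
  have hB : IsBase (grp F n) (insert 0 (Set.range v)) := by
    intro g hg hfix
    obtain ⟨π, w, hπ⟩ := grp_form g hg
    have hw : ∀ i, w i = 0 := fun i => by
      have := hπ 0 i
      rw [hfix 0 (by simp)] at this
      simpa using this.symm
    have hp : ∀ i, π i = i := fun i => by
      apply e.injective
      apply Subtype.ext
      funext j
      have := hπ (v j) i
      rw [hfix (v j) (by simp), hw, add_zero] at this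
      exact this.symm
    ext x i
    rw [hπ, hw, hp]; simp
  have hle : baseSize (grp F n) ≤ (insert 0 (Set.range v)).ncard := Nat.sInf_le ⟨_, hB, rfl⟩
  refine hle.trans ?_
  refine (Set.ncard_insert_le _ _).trans ?_
  have : (Set.range v).ncard ≤ k := by
    rw [← Set.image_univ]
    refine (Set.ncard_image_le).trans ?_
    simp [Set.ncard_univ]
  omega

theorem inj_of_base {F : Type*} [Field F] {n : ℕ} (h3 : 3 ≤ n)
    (E : Set (zeroSum F n)) (hE : IsBase (grp F n) E) (u : zeroSum F n) :
    Function.Injective (fun (i : Fin n) (e : ↥(E \ {u})) => (e.1 : Fin n → F) i - (u : Fin n → F) i) := by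
  intro i j hij
  by_contra hne
  have hij' : ∀ e ∈ E, (e : Fin n → F) i - (u : Fin n → F) i = (e : Fin n → F) j - (u : Fin n → F) j := by
    intro e he
    by_cases h : e = u
    · simp [h]
    · exact congrFun hij ⟨e, he, h⟩
  let g : Equiv.Perm (zeroSum F n) :=
    Equiv.addRight u * coordPerm (Equiv.swap i j) * Equiv.addRight (-u)
  have hg : g ∈ grp F n := by
    refine mul_mem (mul_mem ?_ ?_) ?_ <;> apply Subgroup.subset_closure
    · exact Or.inl ⟨_, rfl⟩
    · exact Or.inr ⟨_, rfl⟩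
    · exact Or.inl ⟨_, rfl⟩
  have hga : ∀ (x : zeroSum F n) (l : Fin n), (g x : Fin n → F) l =
      (x : Fin n → F) (Equiv.swap i j l) - (u : Fin n → F) (Equiv.swap i j l) + (u : Fin n → F) l := by
    intro x l
    simp only [g, Equiv.Perm.mul_apply, Equiv.coe_addRight, AddSubgroup.coe_add, Pi.add_apply,
      coordPerm_apply, Equiv.symm_swap, AddSubgroup.coe_neg, Pi.neg_apply, sub_eq_add_neg]
  have h1 : g = 1 := by
    apply hE g hg
    intro e he
    ext l
    rw [hga]
    have := hij' e he
    by_cases hli : l = i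
    · subst hli; rw [Equiv.swap_apply_left, ← this]; ring
    by_cases hlj : l = j
    · subst hlj; rw [Equiv.swap_apply_right, this]; ring
    rw [Equiv.swap_apply_of_ne_of_ne hli hlj]; ring
  obtain ⟨l, hl⟩ : ∃ l : Fin n, l ∉ ({i, j} : Finset (Fin n)) := by
    by_contra! h
    have : (univ : Finset (Fin n)) ⊆ {i, j} := fun x _ => h x
    have := (card_le_card this).trans card_le_two
    simp at this; omega
  simp only [mem_insert, mem_singleton, not_or] at hl
  let x : zeroSum F n := ⟨Pi.single i 1 - Pi.single l 1, by
    change ∑ m, _ = 0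
    simp⟩
  have h2 := hga (x + u) i
  rw [h1] at h2
  simp [x, hne, Ne.symm hne, hl.1, hl.2, Ne.symm hl.1, Ne.symm hl.2, Pi.single_apply] at h2

theorem key {F : Type*} [Field F] [Fintype F] (k n : ℕ) (hk : 2 ≤ k)
    (hn : n = Fintype.card F ^ k - 1) (w u : zeroSum F n) (h : SaxlAdj (grp F n) w u)
    (φ : F → ℤ) : ∑ i, φ ((w : Fin n → F) i - (u : Fin n → F) i) =
      (Fintype.card F : ℤ) ^ (k - 1) * ∑ c, φ c - φ 0 := by
  classical
  obtain ⟨hne, E, ⟨hE, hcard⟩, hw, hu⟩ := h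
  have hq2 : 2 ≤ Fintype.card F := Fintype.one_lt_card
  have hqk : Fintype.card F ^ k = Fintype.card F * Fintype.card F ^ (k - 1) := by
    rw [← pow_succ']; congr 1; omega
  have hqp : 2 ≤ Fintype.card F ^ (k - 1) :=
    hq2.trans (Nat.le_self_pow (by omega) _)
  have h3 : 3 ≤ n := by
    have : 2 * 2 ≤ Fintype.card F * Fintype.card F ^ (k - 1) := Nat.mul_le_mul hq2 hqp
    omega
  have hinj := inj_of_base h3 E hE u
  set f := (fun (i : Fin n) (e : ↥(E \ {u})) => (e.1 : Fin n → F) i - (u : Fin n → F) i) with hf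
  have hle := baseSize_le (F := F) k n hk hn
  have hι : Fintype.card ↥(E \ {u}) + 1 = E.ncard := by
    rw [← Set.ncard_sdiff_singleton_add_one hu, ← Nat.card_eq_fintype_card]
    rfl
  have hcι : Fintype.card ↥(E \ {u}) = k := by
    have hc := Fintype.card_le_of_injective f hinj
    simp only [Fintype.card_fin, Fintype.card_pi, prod_const, card_univ] at hc
    by_contra hlt
    have : Fintype.card F ^ (Fintype.card ↥(E \ {u})) ≤ Fintype.card F ^ (k - 1) :=
      Nat.pow_le_pow_right (by omega) (by omega)
    have : 2 * Fintype.card F ^ (k - 1) ≤ Fintype.card F * Fintype.card F ^ (k - 1) :=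
      Nat.mul_le_mul_right _ hq2
    omega
  let jw : ↥(E \ {u}) := ⟨w, hw, hne⟩
  have hcompl : ((univ.image f)ᶜ : Finset (↥(E \ {u}) → F)).card = 1 := by
    rw [card_compl, card_image_of_injective _ hinj]
    simp [hcι]
    omega
  obtain ⟨z, hz⟩ := card_eq_one.mp hcompl
  have hsum : ∀ {M : Type} [AddCommGroup M] (ψ : (↥(E \ {u}) → F) → M),
      ∑ i, ψ (f i) + ψ z = ∑ x, ψ x := by
    intro M _ ψ
    rw [← sum_add_sum_compl (univ.image f), hz, sum_singleton, sum_image (fun a _ b _ h => hinj h)]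
  have hsumF : ∀ (ψ : (↥(E \ {u}) → F) → F),
      ∑ i, ψ (f i) + ψ z = ∑ x, ψ x := by
    intro ψ
    rw [← sum_add_sum_compl (univ.image f), hz, sum_singleton, sum_image (fun a _ b _ h => hinj h)]
  have hz0 : ∀ j, z j = 0 := by
    intro j
    have h1 := hsumF (fun x => x j)
    have h2 := sum_coord (F := F) (M := F) j id
    simp only [id] at h2
    rw [h2, hcι] at h1
    have h4 : ∑ i, f i j = 0 := by
      simp only [hf, sum_sub_distrib]
      have a1 : ∑ i, (j.1 : Fin n → F) i = 0 := j.1.2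
      have a2 : ∑ i, (u : Fin n → F) i = 0 := u.2
      rw [a1, a2, sub_zero]
    have : k - 1 ≠ 0 := by omega
    simpa [h4, this] using h1
  have h5 := hsum (fun x => φ (x jw))
  rw [sum_coord, hcι, hz0] at h5
  rw [← h5]
  simp [hf, jw]

theorem shift {F : Type*} [Field F] {n : ℕ} (w a : Fin n → F) (p r : Fin n)
    (hpr : p ≠ r) (hp : a p = 1) (hr : a r = 1) (h0 : ∀ i, i ≠ p → i ≠ r → a i = 0)
    (h : ∀ φ : F → ℤ, ∑ i, φ (w i) = ∑ i, φ (w i - a i)) : w r = w p + 1 := by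
  classical
  have h1 := h (fun c => if c = w p then 1 else 0)
  rw [← sum_add_sum_compl ({p, r} : Finset (Fin n)),
    ← sum_add_sum_compl ({p, r} : Finset (Fin n)) (fun i => if w i - a i = w p then (1:ℤ) else 0)] at h1
  have h2 : ∑ i ∈ ({p, r} : Finset (Fin n))ᶜ, (if w i = w p then (1:ℤ) else 0) =
      ∑ i ∈ ({p, r} : Finset (Fin n))ᶜ, (if w i - a i = w p then (1:ℤ) else 0) := by
    apply sum_congr rfl
    intro i hi
    simp only [mem_compl, mem_insert, mem_singleton, not_or] at hi
    rw [h0 i hi.1 hi.2, sub_zero]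
  rw [h2, add_left_inj, sum_pair hpr, sum_pair hpr, hp, hr] at h1
  by_contra hne
  have h3 : ¬ (w r - 1 = w p) := fun h => hne (by rw [← h]; ring)
  simp [h3] at h1
  split_ifs at h1 <;> simp at h1

theorem main {F : Type*} [Field F] [Fintype F]
    (hq : Even (Fintype.card F)) (k : ℕ) (hk : 2 ≤ k)
    (n : ℕ) (hn : n = Fintype.card F ^ k - 1) :
    ∃ a b : (zeroSum F n),
      (∀ i : Fin n, (a : Fin n → F) i =
        if (i : ℕ) = 0 then 1 else if (i : ℕ) = 1 then 1 else 0) ∧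
      (∀ i : Fin n, (b : Fin n → F) i =
        if (i : ℕ) = 0 then 1 else if (i : ℕ) = 2 then 1 else 0) ∧
      a ≠ b ∧ a ≠ a + b ∧ a ≠ 0 ∧ b ≠ a + b ∧ b ≠ 0 ∧ a + b ≠ 0 ∧
      ¬∃ w : (zeroSum F n), SaxlAdj (grp F n) w a ∧ SaxlAdj (grp F n) w b ∧
        SaxlAdj (grp F n) w (a + b) ∧ SaxlAdj (grp F n) w 0 := by
  classical
  have h3 : 3 ≤ n := by
    have hq2 : 2 ≤ Fintype.card F := Fintype.one_lt_card
    have : 2 ^ 2 ≤ Fintype.card F ^ k :=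
      (Nat.pow_le_pow_left hq2 2).trans (Nat.pow_le_pow_right (by omega) hk)
    omega
  have hrc : ringChar F = 2 := FiniteField.even_card_iff_char_two.mpr (Nat.even_iff.mp hq)
  have two : (1 : F) + 1 = 0 := by
    have := ringChar.Nat.cast_ringChar (R := F)
    rw [hrc] at this
    rw [one_add_one_eq_two]; exact_mod_cast this
  let i0 : Fin n := ⟨0, by omega⟩
  let i1 : Fin n := ⟨1, by omega⟩
  let i2 : Fin n := ⟨2, by omega⟩
  have h01 : i0 ≠ i1 := by simp [i0, i1]
  have h02 : i0 ≠ i2 := by simp [i0, i2]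
  have h12 : i1 ≠ i2 := by simp [i1, i2]
  have mk : ∀ p r : Fin n, p ≠ r → (fun i => if i = p then (1 : F) else if i = r then 1 else 0) ∈ zeroSum F n := by
    intro p r hpr
    change ∑ i, _ = 0
    have : ∀ i, (if i = p then (1 : F) else if i = r then 1 else 0) = (if i = p then 1 else 0) + (if i = r then 1 else 0) := by
      intro i; split_ifs <;> simp_all
    simp only [this, sum_add_distrib]
    simp [two]
  let a : zeroSum F n := ⟨_, mk i0 i1 h01⟩
  let b : zeroSum F n := ⟨_, mk i0 i2 h02⟩
  have ha : ∀ i, (a : Fin n → F) i = if i = i0 then (1 : F) else if i = i1 then 1 else 0 := fun i => rfl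
  have hb : ∀ i, (b : Fin n → F) i = if i = i0 then (1 : F) else if i = i2 then 1 else 0 := fun i => rfl
  have ev : ∀ {x y : zeroSum F n}, x = y → ∀ i, (x : Fin n → F) i = (y : Fin n → F) i :=
    fun h i => by rw [h]
  refine ⟨a, b, ?_, ?_, ?_, ?_, ?_, ?_, ?_, ?_, ?_⟩
  · intro i; simp [ha, i0, i1, Fin.ext_iff]
  · intro i; simp [hb, i0, i2, Fin.ext_iff]
  · intro h; have := ev h i1; simp [ha, hb, h01.symm, h12] at this
  · intro h; have := ev h i0; simp [ha, hb] at this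
  · intro h; have := ev h i0; simp [ha] at this
  · intro h; have := ev h i0; simp [ha, hb] at this
  · intro h; have := ev h i0; simp [hb] at this
  · intro h; have := ev h i1; simp [ha, hb, h01.symm, h12] at this
  · rintro ⟨w, wa, wb, wab, w0⟩
    have k0 := fun φ => key k n hk hn w 0 w0 φ
    simp only [AddSubgroup.coe_zero, Pi.zero_apply, sub_zero] at k0
    have e1 := shift (w : Fin n → F) a i0 i1 h01 (by simp [ha]) (by simp [ha])
      (by intro i h h'; simp [ha, h, h']) (fun φ => by rw [k0, key k n hk hn w a wa])
    have e2 := shift (w : Fin n → F) b i0 i2 h02 (by simp [hb]) (by simp [hb])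
      (by intro i h h'; simp [hb, h, h']) (fun φ => by rw [k0, key k n hk hn w b wb])
    have e3 := shift (w : Fin n → F) (a + b : zeroSum F n) i1 i2 h12
      (by simp [ha, hb, h01.symm, h12]) (by simp [ha, hb, h02.symm, h12.symm])
      (by
        intro i h h'
        by_cases hi : i = i0
        · simp [ha, hb, hi, two]
        · simp [ha, hb, h, h', hi]) (fun φ => by rw [k0, key k n hk hn w _ wab])
    rw [e2, e1] at e3
    simp at e3

theorem gossip {F : Type*} [Field F] [Fintype F] (n : ℕ) (G : Subgroup (Equiv.Perm (zeroSum F n)))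
    (a b : zeroSum F n) (h1 : a ≠ b) (h2 : a ≠ a + b) (h3 : a ≠ 0) (h4 : b ≠ a + b)
    (h5 : b ≠ 0) (h6 : a + b ≠ 0)
    (h : ¬∃ w : (zeroSum F n), SaxlAdj G w a ∧ SaxlAdj G w b ∧
        SaxlAdj G w (a + b) ∧ SaxlAdj G w 0) : saxlGossip G 4 = 0 := by
  classical
  unfold saxlGossip
  split_ifs
  · apply Nat.sInf_eq_zero.mpr
    left
    refine ⟨(({a, b, a + b, 0} : Finset (zeroSum F n)) : Set (zeroSum F n)), ?_, ?_⟩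
    · rw [Set.ncard_coe_finset]
      rw [card_insert_of_notMem, card_insert_of_notMem, card_insert_of_notMem, card_singleton] <;>
        simp only [mem_insert, mem_singleton, not_or] <;> tauto
    · have : {γ | ∀ s ∈ (({a, b, a + b, 0} : Finset (zeroSum F n)) : Set (zeroSum F n)), SaxlAdj G γ s} = ∅ := by
        ext γ
        simp only [Set.mem_setOf_eq, Set.mem_empty_iff_false, iff_false]
        intro hγ
        exact h ⟨γ, hγ a (by simp), hγ b (by simp), hγ (a + b) (by simp), hγ 0 (by simp)⟩
      rw [this, Set.ncard_empty]
  · rfl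

end Saxl11

theorem statement_11 {F : Type*} [Field F] [Fintype F]
    (hq : Even (Fintype.card F)) (k : ℕ) (hk : 2 ≤ k)
    (n : ℕ) (hn : n = Fintype.card F ^ k - 1)
    (G : Subgroup (Equiv.Perm (zeroSum F n)))
    (hG : G = Subgroup.closure
      ({e | ∃ w : (zeroSum F n), e = Equiv.addRight w} ∪
       {e | ∃ π : Equiv.Perm (Fin n), e = coordPerm π})) :
    saxlGossip G 4 = 0 ∧
    ∃ a b : (zeroSum F n),
      (∀ i : Fin n, (a : Fin n → F) i =
        if (i : ℕ) = 0 then 1 else if (i : ℕ) = 1 then 1 else 0) ∧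
      (∀ i : Fin n, (b : Fin n → F) i =
        if (i : ℕ) = 0 then 1 else if (i : ℕ) = 2 then 1 else 0) ∧
      a ≠ b ∧ a ≠ a + b ∧ a ≠ 0 ∧ b ≠ a + b ∧ b ≠ 0 ∧ a + b ≠ 0 ∧
      ¬∃ w : (zeroSum F n), SaxlAdj G w a ∧ SaxlAdj G w b ∧
        SaxlAdj G w (a + b) ∧ SaxlAdj G w 0 := by
  obtain ⟨a, b, ha, hb, h1, h2, h3, h4, h5, h6, h⟩ := Saxl11.main hq k hk n hn
  have hG' : G = Saxl11.grp F n := hG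
  subst hG'
  exact ⟨Saxl11.gossip n _ a b h1 h2 h3 h4 h5 h6 h, a, b, ha, hb, h1, h2, h3, h4, h5, h6, h⟩
end

section
/- Let Ω be a finite set and G ≤ Sym(Ω) a transitive permutation group with b(G) ∈ {3, 4}. If the common degree of the vertices of the Saxl hypergraph Σ(G) (the number of edges of Σ(G) containing a given point) is a prime number, then |Ω| = 4 and G = Sym(Ω). -/
section Aux
open Equiv

/-- Stabiliser of a point in a permutation group. -/
def fx {Ω : Type*} (K : Subgroup (Perm Ω)) (x : Ω) : Subgroup (Perm Ω) :=
  K ⊓ MulAction.stabilizer (Perm Ω) x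

/-- Orbit of a point. -/
def ob {Ω : Type*} (K : Subgroup (Perm Ω)) (x : Ω) : Set Ω := {y | ∃ g ∈ K, g x = y}

variable {Ω : Type*}

lemma mem_fx {K : Subgroup (Perm Ω)} {x : Ω} {g : Perm Ω} : g ∈ fx K x ↔ g ∈ K ∧ g x = x := by
  simp [fx, Subgroup.mem_inf, MulAction.mem_stabilizer_iff]

lemma fx_le (K : Subgroup (Perm Ω)) (x : Ω) : fx K x ≤ K := inf_le_left

lemma self_mem_ob (K : Subgroup (Perm Ω)) (x : Ω) : x ∈ ob K x := ⟨1, K.one_mem, rfl⟩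

lemma ob_eq {K : Subgroup (Perm Ω)} {x y : Ω} (h : y ∈ ob K x) : ob K y = ob K x := by
  obtain ⟨g, hg, rfl⟩ := h
  ext z
  constructor
  · rintro ⟨k, hk, rfl⟩
    exact ⟨k * g, K.mul_mem hk hg, rfl⟩
  · rintro ⟨k, hk, rfl⟩
    exact ⟨k * g⁻¹, K.mul_mem hk (K.inv_mem hg), by simp⟩

lemma card_ob [Finite Ω] (K : Subgroup (Perm Ω)) (x : Ω) :
    (ob K x).ncard * Nat.card (fx K x) = Nat.card K := by
  have h1 : ob K x = MulAction.orbit K x := by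
    ext y
    simp [ob, MulAction.mem_orbit_iff, Subgroup.smul_def]
  have h2 : Nat.card (fx K x) = Nat.card (MulAction.stabilizer K x) := by
    have : (fx K x).subgroupOf K = MulAction.stabilizer K x := by
      ext g
      simp [Subgroup.mem_subgroupOf, mem_fx, MulAction.mem_stabilizer_iff, Subgroup.smul_def]
    rw [← this]
    exact (Nat.card_congr (Subgroup.subgroupOfEquivOfLe (fx_le K x)).toEquiv).symm
  rw [h1, h2, ← MulAction.index_stabilizer, mul_comm, Subgroup.card_mul_index]

lemma card_fx_eq [Finite Ω] {K : Subgroup (Perm Ω)} {x y : Ω} (h : y ∈ ob K x) :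
    Nat.card (fx K y) = Nat.card (fx K x) := by
  have h1 := card_ob K x
  have h2 := card_ob K y
  rw [ob_eq h] at h2
  have : 0 < (ob K x).ncard := by
    rw [Set.ncard_pos]
    exact ⟨x, self_mem_ob K x⟩
  exact Nat.eq_of_mul_eq_mul_left this (h2.trans h1.symm)

lemma sub_eq [Finite Ω] {A B : Subgroup (Perm Ω)} (h : A ≤ B) (hc : Nat.card B ≤ Nat.card A) :
    A = B := Subgroup.eq_of_le_of_card_ge h hc

lemma two_le_card [Finite Ω] {A : Subgroup (Perm Ω)} (h : A ≠ ⊥) : 2 ≤ Nat.card A := by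
  have := (Subgroup.one_lt_card_iff_ne_bot A).2 h
  omega

/-- If `A` has order two and meets `B` nontrivially then it lies in `B`. -/
lemma le_of_two [Finite Ω] {A B : Subgroup (Perm Ω)} (h : Nat.card A = 2) (hn : A ⊓ B ≠ ⊥) :
    A ≤ B := by
  have := sub_eq (inf_le_left : A ⊓ B ≤ A) (by rw [h]; exact two_le_card hn)
  exact inf_eq_left.1 this

lemma eq_of_six [Finite Ω] {A B C D : Subgroup (Perm Ω)} (hA : Nat.card A = 2)
    (hB : Nat.card B = 2) (hAB : A ⊓ B = ⊥) (hD : Nat.card D = 6) (hCD : C ≤ D)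
    (hAC : A ≤ C) (hBC : B ≤ C) : C = D := by
  have h1 := Subgroup.mul_injective_of_disjoint (disjoint_iff.2 hAB)
  have h2 : Nat.card (A × B) ≤ Nat.card C := by
    apply Nat.card_le_card_of_injective
      (fun g : A × B => (⟨g.1 * g.2, C.mul_mem (hAC g.1.2) (hBC g.2.2)⟩ : C))
    intro u v huv
    apply h1
    simpa using huv
  rw [Nat.card_prod, hA, hB] at h2
  have h3 := Subgroup.card_dvd_of_le hCD
  rw [hD] at h3
  apply sub_eq hCD
  have h4 := Nat.le_of_dvd (by norm_num) h3
  rw [hD]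
  interval_cases Nat.card C <;> omega

/-- Conjugation of point stabilisers. -/
lemma fx_conj {K : Subgroup (Perm Ω)} {x : Ω} {g : Perm Ω} (hg : g ∈ K) (h : Perm Ω) :
    h ∈ fx K (g x) ↔ g⁻¹ * h * g ∈ fx K x := by
  rw [mem_fx, mem_fx]
  constructor
  · rintro ⟨h1, h2⟩
    exact ⟨K.mul_mem (K.mul_mem (K.inv_mem hg) h1) hg, by simp [h2]⟩
  · rintro ⟨h1, h2⟩
    refine ⟨?_, ?_⟩
    · have := K.mul_mem (K.mul_mem hg h1) (K.inv_mem hg)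
      simpa [mul_assoc] using this
    · have := congrArg g h2
      simpa using this

/-- On an orbit of prime length, point stabilisers are all distinct or all equal. -/
lemma prime_orbit [Finite Ω] {K : Subgroup (Perm Ω)} {x y z : Ω} (hp : (ob K x).ncard.Prime)
    (hy : y ∈ ob K x) (hxy : x ≠ y) (he : fx K x = fx K y) (hz : z ∈ ob K x) :
    fx K x = fx K z := by
  let N : Subgroup (Perm Ω) := K ⊓ Subgroup.normalizer (fx K x : Set (Perm Ω))
  have key : ∀ g ∈ K, (g ∈ N ↔ fx K x = fx K (g x)) := by
    intro g hg
    have : g ∈ N ↔ ∀ h, h ∈ fx K x ↔ g⁻¹ * h * g ∈ fx K x := by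
      simp only [N, Subgroup.mem_inf, hg, true_and]
      exact Subgroup.mem_normalizer_iff''
    rw [this, SetLike.ext_iff]
    simp only [fx_conj hg]
  have hle : fx K x ≤ N := by
    intro g hg
    rw [key g (fx_le _ _ hg), (mem_fx.1 hg).2]
  obtain ⟨g, hg, rfl⟩ := hy
  have hgN : g ∈ N := (key g hg).2 he
  have hNK : N ≤ K := inf_le_left
  have hNe : N = K := by
    obtain ⟨a, ha⟩ := Subgroup.card_dvd_of_le hle
    obtain ⟨c, hc⟩ := Subgroup.card_dvd_of_le hNK
    have hk := card_ob K x
    have hpos : 0 < Nat.card (fx K x) := Nat.card_pos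
    have hac : (ob K x).ncard = a * c := by
      apply Nat.eq_of_mul_eq_mul_right hpos
      rw [hk, hc, ha]; ring
    rw [hac] at hp
    rcases Nat.prime_mul_iff.1 hp with ⟨_, h1⟩ | ⟨_, h1⟩
    · apply sub_eq hNK
      rw [hc, h1, mul_one]
    · exfalso
      have : fx K x = N := sub_eq hle (by rw [ha, h1, mul_one])
      rw [← this] at hgN
      exact hxy (mem_fx.1 hgN).2.symm
  obtain ⟨k, hk, rfl⟩ := hz
  exact (key k hk).1 (hNe ▸ hk)

lemma free_dvd {H X : Type*} [Group H] [Finite H] [Finite X] [MulAction H X] 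
    (hf : ∀ x : X, MulAction.stabilizer H x = ⊥) :
    Nat.card H ∣ Nat.card X := by
  rw [Nat.card_congr (MulAction.selfEquivSigmaOrbitsQuotientStabilizer H X)]
  have : Fintype (Quotient (MulAction.orbitRel H X)) := Fintype.ofFinite _
  rw [Nat.card_sigma]
  apply Finset.dvd_sum
  intro i _
  have h := Subgroup.card_mul_index (MulAction.stabilizer H i.out)
  rw [hf] at h ⊢
  rw [Subgroup.card_bot, one_mul] at h
  rw [← h]
  exact dvd_rfl

/-- Tuples completing a point to an edge. -/
def Tup (G : Subgroup (Perm Ω)) (k : ℕ) (α : Ω) : Set (Fin k → Ω) :=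
  {f | IsSaxlEdge G (insert α (Set.range f))}

lemma tup_inj [Finite Ω] {G : Subgroup (Perm Ω)} {k : ℕ} {α : Ω} (hb : baseSize G = k + 1)
    {f : Fin k → Ω} (hf : f ∈ Tup G k α) : Function.Injective f ∧ α ∉ Set.range f := by
  have h1 : (insert α (Set.range f)).ncard = k + 1 := hf.2.trans hb
  have h2 : (Set.range f).ncard ≤ k := by
    rw [← Set.image_univ]
    refine (Set.ncard_image_le).trans ?_
    simp
  have h3 : α ∉ Set.range f := by
    intro h
    rw [Set.insert_eq_of_mem h] at h1
    omega
  refine ⟨?_, h3⟩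
  rw [Set.ncard_insert_of_notMem h3] at h1
  have h4 : (f '' Set.univ).ncard = (Set.univ : Set (Fin k)).ncard := by
    rw [Set.image_univ]; simp; omega
  have := Set.injOn_of_ncard_image_eq h4
  exact Set.injOn_univ.1 this

lemma tup_card [Finite Ω] {G : Subgroup (Perm Ω)} {k : ℕ} {α : Ω} (hb : baseSize G = k + 1)
    {d : ℕ} (hd : {E : Set Ω | IsSaxlEdge G E ∧ α ∈ E}.ncard = d) :
    Nat.card (Tup G k α) = d * k.factorial := by
  classical
  let S : Set (Set Ω) := {E : Set Ω | IsSaxlEdge G E ∧ α ∈ E}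
  let e : (Σ E : S, (Fin k ≃ (E.1 \ {α} : Set Ω))) → Tup G k α := fun p =>
    ⟨fun i => (p.2 i).1, by
      have : Set.range (fun i => (p.2 i).1) = p.1.1 \ {α} := by
        ext z
        constructor
        · rintro ⟨i, rfl⟩
          exact (p.2 i).2
        · intro hz
          exact ⟨p.2.symm ⟨z, hz⟩, by simp⟩
      show IsSaxlEdge G _
      rw [this, Set.insert_sdiff_singleton, Set.insert_eq_of_mem p.1.2.2]
      exact p.1.2.1⟩
  have hr : ∀ p, insert α (Set.range (e p).1) = p.1.1 := by
    intro p
    have : Set.range (e p).1 = p.1.1 \ {α} := by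
      ext z
      constructor
      · rintro ⟨i, rfl⟩
        exact (p.2 i).2
      · intro hz
        exact ⟨p.2.symm ⟨z, hz⟩, by simp [e]⟩
    rw [this, Set.insert_sdiff_singleton, Set.insert_eq_of_mem p.1.2.2]
  have he : Function.Bijective e := by
    constructor
    · intro p q hpq
      have h1 : p.1 = q.1 := by
        apply Subtype.ext
        rw [← hr p, ← hr q, hpq]
      obtain ⟨E, p⟩ := p
      obtain ⟨E', q⟩ := q
      dsimp at h1
      subst h1
      congr 1
      ext i
      exact congrFun (congrArg Subtype.val hpq) i
    · rintro ⟨f, hf⟩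
      obtain ⟨hi, ha⟩ := tup_inj hb hf
      have hs : (insert α (Set.range f) : Set Ω) \ {α} = Set.range f := by
        simp [ha]
      refine ⟨⟨⟨insert α (Set.range f), hf, Set.mem_insert _ _⟩,
        (Equiv.ofInjective f hi).trans (Equiv.setCongr hs.symm)⟩, ?_⟩
      apply Subtype.ext
      funext i
      simp [e]
  rw [← Nat.card_congr (Equiv.ofBijective e he)]
  have : Fintype S := Fintype.ofFinite _
  rw [Nat.card_sigma]
  have hE : ∀ E : S, Nat.card (Fin k ≃ (E.1 \ {α} : Set Ω)) = k.factorial := by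
    intro E
    have h1 : (E.1 \ {α}).ncard = k := by
      rw [Set.ncard_sdiff_singleton_of_mem E.2.2, E.2.1.2, hb]
      rfl
    have e0 : Fin k ≃ (E.1 \ {α} : Set Ω) := (Finite.equivFinOfCardEq h1).symm
    rw [← Nat.card_congr (Equiv.equivCongr (Equiv.refl (Fin k)) e0)]
    exact Nat.card_perm.trans (by rw [Nat.card_fin])
  simp only [hE, Finset.sum_const, smul_eq_mul, Finset.card_univ]
  rw [← Nat.card_eq_fintype_card, ← hd]
  rfl

lemma key [Finite Ω] {G : Subgroup (Perm Ω)} {k : ℕ} {α : Ω} (hb : baseSize G = k + 1)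
    {d : ℕ} (hd : {E : Set Ω | IsSaxlEdge G E ∧ α ∈ E}.ncard = d) :
    Nat.card (fx G α) ∣ d * k.factorial ∧ (Nat.card (fx G α) = d * k.factorial →
      ∀ f ∈ Tup G k α, ∀ f' ∈ Tup G k α, ∃ h ∈ fx G α, ∀ i, h (f i) = f' i) := by
  have hinv : ∀ h ∈ fx G α, ∀ f ∈ Tup G k α, (fun i => h (f i)) ∈ Tup G k α := by
    intro h hh f hf
    obtain ⟨hG, hα⟩ := mem_fx.1 hh
    have himg : insert α (Set.range fun i => h (f i)) = h '' (insert α (Set.range f)) := by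
      rw [Set.image_insert_eq, hα, ← Set.range_comp]
      rfl
    show IsSaxlEdge G _
    rw [himg]
    refine ⟨?_, ?_⟩
    · intro g hg hfix
      have := hf.1 (h⁻¹ * g * h) (G.mul_mem (G.mul_mem (G.inv_mem hG) hg) hG) (by
        intro b hb'
        have := hfix (h b) ⟨b, hb', rfl⟩
        simp [this])
      have h2 : g = h * (h⁻¹ * g * h) * h⁻¹ := by group
      rw [h2, this]; simp
    · rw [Set.ncard_image_of_injective _ h.injective]
      exact hf.2
  have hfree : ∀ f ∈ Tup G k α, ∀ h ∈ fx G α, (∀ i, h (f i) = f i) → h = 1 := by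
    intro f hf h hh hi
    obtain ⟨hG, hα⟩ := mem_fx.1 hh
    apply hf.1 h hG
    rintro b (rfl | ⟨i, rfl⟩)
    · exact hα
    · exact hi i
  let act : MulAction (fx G α) (Tup G k α) :=
    { smul := fun h f => ⟨fun i => h.1 (f.1 i), hinv h.1 h.2 f.1 f.2⟩
      one_smul := fun f => rfl
      mul_smul := fun g h f => rfl }
  have hst : ∀ f : Tup G k α, MulAction.stabilizer (fx G α) f = ⊥ := by
    intro f
    rw [eq_bot_iff]
    intro h hh
    rw [MulAction.mem_stabilizer_iff] at hh
    rw [Subgroup.mem_bot]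
    apply Subtype.ext
    exact hfree f.1 f.2 h.1 h.2 (fun i => congrFun (congrArg Subtype.val hh) i)
  rw [← tup_card hb hd]
  refine ⟨free_dvd hst, ?_⟩
  intro hc f hf f' hf'
  have hinj : Function.Injective (fun h : fx G α => h • (⟨f, hf⟩ : Tup G k α)) := by
    intro g h hgh
    have : h⁻¹ * g ∈ MulAction.stabilizer (fx G α) (⟨f, hf⟩ : Tup G k α) := by
      rw [MulAction.mem_stabilizer_iff, mul_smul]
      dsimp at hgh
      rw [hgh, inv_smul_smul]
    rw [hst, Subgroup.mem_bot] at this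
    exact (inv_mul_eq_one.1 this).symm
  have hbij := (Nat.bijective_iff_injective_and_card _).2 ⟨hinj, hc⟩
  obtain ⟨h, hh⟩ := hbij.2 ⟨f', hf'⟩
  exact ⟨h.1, h.2, fun i => congrFun (congrArg Subtype.val hh) i⟩


lemma ncard_le_tup [Finite Ω] {k : ℕ} (α : Ω) (f : Fin k → Ω) :
    (insert α (Set.range f)).ncard ≤ k + 1 := by
  refine (Set.ncard_insert_le _ _).trans ?_
  have h2 : (Set.range f).ncard ≤ k := by
    rw [← Set.image_univ]
    refine (Set.ncard_image_le).trans ?_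
    simp
  omega

lemma base_iff {G : Subgroup (Perm Ω)} {k : ℕ} {α : Ω} {f : Fin k → Ω} :
    IsBase G (insert α (Set.range f)) ↔ ∀ g ∈ fx G α, (∀ i, g (f i) = f i) → g = 1 := by
  constructor
  · intro h g hg hi
    obtain ⟨hG, hα⟩ := mem_fx.1 hg
    apply h g hG
    rintro b (rfl | ⟨i, rfl⟩)
    · exact hα
    · exact hi i
  · intro h g hg hi
    exact h g (mem_fx.2 ⟨hg, hi α (Set.mem_insert _ _)⟩)
      (fun i => hi _ (Set.mem_insert_of_mem _ ⟨i, rfl⟩))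

lemma tup_iff [Finite Ω] {G : Subgroup (Perm Ω)} {k : ℕ} {α : Ω} (hb : baseSize G = k + 1)
    {f : Fin k → Ω} :
    f ∈ Tup G k α ↔ ∀ g ∈ fx G α, (∀ i, g (f i) = f i) → g = 1 := by
  rw [← base_iff]
  refine ⟨fun h => h.1, fun h => ⟨h, ?_⟩⟩
  apply le_antisymm
  · rw [hb]; exact ncard_le_tup α f
  · exact Nat.sInf_le ⟨_, h, rfl⟩

lemma nobase [Finite Ω] {G : Subgroup (Perm Ω)} {k j : ℕ} {α : Ω} (hb : baseSize G = k + 1)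
    (hj : j < k) (f : Fin j → Ω) : ¬ ∀ g ∈ fx G α, (∀ i, g (f i) = f i) → g = 1 := by
  rw [← base_iff]
  intro h
  have h1 : baseSize G ≤ _ := Nat.sInf_le ⟨_, h, rfl⟩
  have := ncard_le_tup α f
  omega

lemma nobase1 [Finite Ω] {G : Subgroup (Perm Ω)} {k : ℕ} {α : Ω} (hb : baseSize G = k + 1)
    (hj : 1 < k) (x : Ω) : fx (fx G α) x ≠ ⊥ := by
  intro h
  refine nobase hb hj ![x] (α := α) ?_
  intro g hg hi
  rw [← Subgroup.mem_bot, ← h]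
  exact mem_fx.2 ⟨hg, hi 0⟩

lemma nobase2 [Finite Ω] {G : Subgroup (Perm Ω)} {k : ℕ} {α : Ω} (hb : baseSize G = k + 1)
    (hj : 2 < k) (x y : Ω) : fx (fx (fx G α) x) y ≠ ⊥ := by
  intro h
  refine nobase hb hj ![x, y] (α := α) ?_
  intro g hg hi
  rw [← Subgroup.mem_bot, ← h]
  exact mem_fx.2 ⟨mem_fx.2 ⟨hg, hi 0⟩, hi 1⟩

lemma tup2_iff [Finite Ω] {G : Subgroup (Perm Ω)} {α : Ω} (hb : baseSize G = 2 + 1)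
    (x y : Ω) : ![x, y] ∈ Tup G 2 α ↔ fx (fx (fx G α) x) y = ⊥ := by
  rw [tup_iff hb, Subgroup.eq_bot_iff_forall]
  constructor
  · intro h g hg
    obtain ⟨hg, hy⟩ := mem_fx.1 hg
    obtain ⟨hg, hx⟩ := mem_fx.1 hg
    refine h g hg ?_
    intro i
    fin_cases i
    · exact hx
    · exact hy
  · intro h g hg hi
    exact h g (mem_fx.2 ⟨mem_fx.2 ⟨hg, hi 0⟩, hi 1⟩)

lemma tup3_iff [Finite Ω] {G : Subgroup (Perm Ω)} {α : Ω} (hb : baseSize G = 3 + 1)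
    (x y z : Ω) : ![x, y, z] ∈ Tup G 3 α ↔ fx (fx (fx (fx G α) x) y) z = ⊥ := by
  rw [tup_iff hb, Subgroup.eq_bot_iff_forall]
  constructor
  · intro h g hg
    obtain ⟨hg, hz⟩ := mem_fx.1 hg
    obtain ⟨hg, hy⟩ := mem_fx.1 hg
    obtain ⟨hg, hx⟩ := mem_fx.1 hg
    refine h g hg ?_
    intro i
    fin_cases i
    · exact hx
    · exact hy
    · exact hz
  · intro h g hg hi
    exact h g (mem_fx.2 ⟨mem_fx.2 ⟨mem_fx.2 ⟨hg, hi 0⟩, hi 1⟩, hi 2⟩)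

lemma fx_comm (K : Subgroup (Perm Ω)) (x y : Ω) : fx (fx K x) y = fx (fx K y) x := by
  unfold fx; exact inf_right_comm _ _ _

lemma fx_fx (K : Subgroup (Perm Ω)) (x y : Ω) : fx (fx K x) y = fx K x ⊓ fx K y := by
  ext g
  simp only [Subgroup.mem_inf, mem_fx]
  tauto

lemma ob_two [Finite Ω] {K : Subgroup (Perm Ω)} {x : Ω} (h : fx K x ≠ K) :
    2 ≤ (ob K x).ncard := by
  have h1 := card_ob K x
  by_contra hlt
  apply h
  apply sub_eq (fx_le K x)
  rw [← h1]
  have : (ob K x).ncard ≤ 1 := by omega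
  nlinarith [Nat.zero_le (Nat.card (fx K x))]

lemma ob_lt [Finite Ω] {K L : Subgroup (Perm Ω)} {x y : Ω} (hLK : L ≤ K) (hL : ∀ g ∈ L, g x = x)
    (hy : y ∈ ob K x) (hne : x ≠ y) : ob L y ⊆ ob K x \ {x} := by
  rintro z ⟨g, hg, rfl⟩
  refine ⟨?_, ?_⟩
  · rw [← ob_eq hy]
    exact ⟨g, hLK hg, rfl⟩
  · intro h
    apply hne
    apply g.injective
    rw [hL g hg]
    exact h.symm

lemma ob_lt_card [Finite Ω] {K L : Subgroup (Perm Ω)} {x y : Ω} (hLK : L ≤ K)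
    (hL : ∀ g ∈ L, g x = x)
    (hy : y ∈ ob K x) (hne : x ≠ y) : (ob L y).ncard + 1 ≤ (ob K x).ncard := by
  have := Set.ncard_le_ncard (ob_lt hLK hL hy hne)
  rw [Set.ncard_sdiff_singleton_of_mem (self_mem_ob K x)] at this
  have h2 : 0 < (ob K x).ncard := (Set.ncard_pos).2 ⟨x, self_mem_ob K x⟩
  omega

lemma arith2 {m k d : ℕ} (hd : d.Prime) (hm : 2 ≤ m) (hk : 2 ≤ k) (h : m * k ∣ d * 2) :
    m * k = d * 2 := by
  obtain ⟨r, hr⟩ := h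
  have hd2 := hd.two_le
  have hr0 : r ≠ 0 := by rintro rfl; omega
  have h1 : d ∣ m * k * r := ⟨2, hr.symm⟩
  have main : ∀ a b : ℕ, 2 ≤ b → a * b * r = 2 → r = 1 := by
    intro a b hb hab
    have : b * r ∣ 2 := ⟨a, by rw [← hab]; ring⟩
    have h3 := Nat.le_of_dvd (by norm_num) this
    have : r ≤ 1 := by nlinarith
    omega
  have hr1 : r = 1 := by
    rcases (Nat.Prime.dvd_mul hd).1 h1 with h1 | ⟨a, rfl⟩
    · rcases (Nat.Prime.dvd_mul hd).1 h1 with ⟨a, rfl⟩ | ⟨a, rfl⟩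
      · exact main a k hk (Nat.eq_of_mul_eq_mul_left hd.pos (by rw [hr]; ring))
      · exact main a m hm (Nat.eq_of_mul_eq_mul_left hd.pos (by rw [hr]; ring))
    · exfalso
      have : 2 = m * k * a := Nat.eq_of_mul_eq_mul_left hd.pos (by rw [hr]; ring)
      have ha : a ≠ 0 := by rintro rfl; simp at this
      have ha : 1 ≤ a := by omega
      have : 4 ≤ m * k := by nlinarith
      nlinarith
  rw [hr, hr1, mul_one]

lemma arith3 {m k q d : ℕ} (hd : d.Prime) (hm : 2 ≤ m) (hk : 2 ≤ k) (hq : 2 ≤ q)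
    (h : m * k * q ∣ d * 6) : m * k * q = d * 6 := by
  obtain ⟨r, hr⟩ := h
  have hd2 := hd.two_le
  have hr0 : r ≠ 0 := by rintro rfl; omega
  have h1 : d ∣ m * k * q * r := ⟨6, hr.symm⟩
  have main : ∀ a b c : ℕ, 2 ≤ b → 2 ≤ c → a * b * c * r = 6 → r = 1 := by
    intro a b c hb hc hab
    have : b * c * r ∣ 6 := ⟨a, by rw [← hab]; ring⟩
    have h3 := Nat.le_of_dvd (by norm_num) this
    have h4 : 4 ≤ b * c := by nlinarith
    have : r ≤ 1 := by nlinarith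
    omega
  have hr1 : r = 1 := by
    rcases (Nat.Prime.dvd_mul hd).1 h1 with h1 | ⟨a, rfl⟩
    · rcases (Nat.Prime.dvd_mul hd).1 h1 with h1 | ⟨a, rfl⟩
      · rcases (Nat.Prime.dvd_mul hd).1 h1 with ⟨a, rfl⟩ | ⟨a, rfl⟩
        · exact main a k q hk hq (Nat.eq_of_mul_eq_mul_left hd.pos (by rw [hr]; ring))
        · exact main a m q hm hq (Nat.eq_of_mul_eq_mul_left hd.pos (by rw [hr]; ring))
      · exact main a m k hm hk (Nat.eq_of_mul_eq_mul_left hd.pos (by rw [hr]; ring))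
    · exfalso
      have : 6 = m * k * q * a := Nat.eq_of_mul_eq_mul_left hd.pos (by rw [hr]; ring)
      have ha : a ≠ 0 := by rintro rfl; simp at this
      have ha : 1 ≤ a := by omega
      have : 4 ≤ m * k := by nlinarith
      have : 8 ≤ m * k * q := by nlinarith
      nlinarith
  rw [hr, hr1, mul_one]

lemma arith2' {m k d : ℕ} (hd : d.Prime) (hk : 2 ≤ k) (hkm : k + 1 ≤ m)
    (h : m * k = d * 2) : m = d ∧ k = 2 := by
  have h1 : d ∣ m * k := ⟨2, h⟩
  rcases (Nat.Prime.dvd_mul hd).1 h1 with ⟨a, rfl⟩ | ⟨a, rfl⟩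
  · have h2 : a * k = 2 := Nat.eq_of_mul_eq_mul_left hd.pos (by rw [← h]; ring)
    have ha : a ≠ 0 := by rintro rfl; simp at h2
    have ha1 : a ≤ 1 := by nlinarith
    have : a = 1 := by omega
    subst this
    omega
  · have h2 : a * m = 2 := Nat.eq_of_mul_eq_mul_left hd.pos (by rw [← h]; ring)
    have ha : a ≠ 0 := by rintro rfl; simp at h2
    have ha1 : 1 ≤ a := by omega
    nlinarith

lemma arith3' {m k q d : ℕ} (hd : d.Prime) (hq : 2 ≤ q) (hqk : q + 1 ≤ k) (hkm : k + 1 ≤ m)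
    (h : m * k * q = d * 6) : m = d ∧ k = 3 ∧ q = 2 := by
  have h1 : d ∣ m * k * q := ⟨6, h⟩
  rcases (Nat.Prime.dvd_mul hd).1 h1 with h1 | ⟨a, rfl⟩
  · rcases (Nat.Prime.dvd_mul hd).1 h1 with ⟨a, rfl⟩ | ⟨a, rfl⟩
    · have h2 : a * (k * q) = 6 := Nat.eq_of_mul_eq_mul_left hd.pos (by rw [← h]; ring)
      have ha : a ≠ 0 := by rintro rfl; simp at h2
      have h6 : 6 ≤ k * q := by nlinarith
      have ha1 : a ≤ 1 := by nlinarith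
      have : a = 1 := by omega
      subst this
      have hq2 : q ≤ 2 := by nlinarith
      have : q = 2 := by omega
      subst this
      omega
    · have h2 : a * (m * q) = 6 := Nat.eq_of_mul_eq_mul_left hd.pos (by rw [← h]; ring)
      have ha : a ≠ 0 := by rintro rfl; simp at h2
      have ha1 : 1 ≤ a := by omega
      have h6 : 8 ≤ m * q := by nlinarith
      nlinarith
  · have h2 : a * (m * k) = 6 := Nat.eq_of_mul_eq_mul_left hd.pos (by rw [← h]; ring)
    have ha : a ≠ 0 := by rintro rfl; simp at h2
    have ha1 : 1 ≤ a := by omega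
    have h6 : 8 ≤ m * k := by nlinarith
    nlinarith

lemma case4 [Finite Ω] {G : Subgroup (Perm Ω)} {α : Ω} (hb : baseSize G = 3 + 1)
    {d : ℕ} (hd : d.Prime) (hdeg : {E : Set Ω | IsSaxlEdge G E ∧ α ∈ E}.ncard = d) : False := by
  obtain ⟨hdvd, htr⟩ := key hb hdeg
  have hne : Nonempty (Tup G 3 α) := by
    apply (Nat.card_pos_iff.1 _).1
    rw [tup_card hb hdeg]
    exact Nat.mul_pos hd.pos (Nat.factorial_pos 3)
  obtain ⟨f, hf⟩ := hne
  obtain ⟨β, γ, δ, rfl⟩ : ∃ β γ δ, f = ![β, γ, δ] :=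
    ⟨f 0, f 1, f 2, by funext i; fin_cases i <;> rfl⟩
  obtain ⟨hinj, -⟩ := tup_inj hb hf
  have hβγ : β ≠ γ := fun h => by simpa using @hinj 0 1 h
  have hγδ : γ ≠ δ := fun h => by simpa using @hinj 1 2 h
  have T := fun x y z => tup3_iff (α := α) hb x y z
  have hbot := (T β γ δ).1 hf
  have N2 := fun x y => nobase2 (α := α) hb (by norm_num) x y
  set H := fx G α with hH
  have c1 := card_ob H β
  have c2 := card_ob (fx H β) γ
  have c3 := card_ob (fx (fx H β) γ) δ
  have hm : 2 ≤ (ob H β).ncard := by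
    apply ob_two
    intro h
    rw [h] at hbot
    exact N2 _ _ hbot
  have hk : 2 ≤ (ob (fx H β) γ).ncard := by
    apply ob_two
    intro h
    rw [h] at hbot
    exact N2 _ _ hbot
  have hq := two_le_card (N2 β γ)
  have hc : Nat.card H = (ob H β).ncard * (ob (fx H β) γ).ncard * Nat.card (fx (fx H β) γ) := by
    rw [← c1, ← c2, mul_assoc]
  have hfac : Nat.factorial 3 = 6 := rfl
  rw [hfac] at hdvd htr
  have hcard := arith3 hd hm hk hq (hc ▸ hdvd)
  have tr := htr (hc.trans hcard)
  obtain ⟨g1, hg1, e1⟩ := tr _ hf ![γ, β, δ] ((T _ _ _).2 (by rw [fx_comm H]; exact hbot))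
  obtain ⟨g2, hg2, e2⟩ := tr _ hf ![β, δ, γ] ((T _ _ _).2 (by rw [fx_comm (fx H β)]; exact hbot))
  have hγ : γ ∈ ob H β := ⟨g1, hg1, e1 0⟩
  have hδ : δ ∈ ob (fx H β) γ := ⟨g2, mem_fx.2 ⟨hg2, e2 0⟩, e2 1⟩
  rw [hbot, Subgroup.card_bot, mul_one] at c3
  have l1 := ob_lt_card (fx_le H β) (fun g hg => (mem_fx.1 hg).2) hγ hβγ
  have l2 := ob_lt_card (fx_le (fx H β) γ) (fun g hg => (mem_fx.1 hg).2) hδ hγδ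
  rw [c3] at l2
  obtain ⟨hmd, hk3, hq2⟩ := arith3' hd hq l2 l1 hcard
  have hsix : Nat.card (fx H β) = 6 := by rw [← c2, hk3, hq2]
  have hsub : ob H β \ {β} ⊆ ob (fx H β) γ := by
    rintro x ⟨hx, hxβ⟩
    by_contra hxn
    have hnb : ∀ y, fx (fx (fx H β) x) y ≠ ⊥ := by
      intro y h
      obtain ⟨g, hg, e⟩ := tr _ hf _ ((T _ _ _).2 h)
      exact hxn ⟨g, mem_fx.2 ⟨hg, e 0⟩, e 1⟩
    have hδ2 : Nat.card (fx (fx H β) δ) = 2 := by rw [card_fx_eq hδ, hq2]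
    have i1 : fx (fx H β) γ ≤ fx (fx H β) x := by
      apply le_of_two hq2
      rw [inf_comm, ← fx_fx]
      exact hnb γ
    have i2 : fx (fx H β) δ ≤ fx (fx H β) x := by
      apply le_of_two hδ2
      rw [inf_comm, ← fx_fx]
      exact hnb δ
    have h6 := eq_of_six hq2 hδ2 (by rw [← fx_fx]; exact hbot) hsix (fx_le _ _) i1 i2
    rw [fx_fx] at h6
    have h7 : fx H β = fx H x :=
      sub_eq (inf_eq_left.1 h6) (by rw [card_fx_eq hx])
    have h8 := prime_orbit (hmd ▸ hd) hx (fun h => hxβ h.symm) h7 hγ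
    have h9 : fx (fx H β) γ = fx H β := by rw [fx_fx, ← h8, inf_idem]
    rw [h9] at hbot
    exact N2 _ _ hbot
  have := Set.ncard_le_ncard hsub
  rw [Set.ncard_sdiff_singleton_of_mem (self_mem_ob H β), hk3] at this
  have h4 : d = 4 := by omega
  rw [h4] at hd
  revert hd
  norm_num

lemma case3 [Fintype Ω] {G : Subgroup (Perm Ω)} (htrans : ∀ α β : Ω, ∃ g ∈ G, g α = β) {α : Ω}
    (hb : baseSize G = 2 + 1)
    {d : ℕ} (hd : d.Prime) (hdeg : {E : Set Ω | IsSaxlEdge G E ∧ α ∈ E}.ncard = d) :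
    Fintype.card Ω = 4 ∧ G = ⊤ := by
  obtain ⟨hdvd, htr⟩ := key hb hdeg
  have hne : Nonempty (Tup G 2 α) := by
    apply (Nat.card_pos_iff.1 _).1
    rw [tup_card hb hdeg]
    exact Nat.mul_pos hd.pos (Nat.factorial_pos 2)
  obtain ⟨f, hf⟩ := hne
  obtain ⟨β, γ, rfl⟩ : ∃ β γ, f = ![β, γ] :=
    ⟨f 0, f 1, by funext i; fin_cases i <;> rfl⟩
  obtain ⟨hinj, hαf⟩ := tup_inj hb hf
  have hβγ : β ≠ γ := fun h => by simpa using @hinj 0 1 h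
  have T := fun x y => tup2_iff (α := α) hb x y
  have hbot := (T β γ).1 hf
  have N1 := fun x => nobase1 (α := α) hb (by norm_num) x
  have hcG := card_ob G α
  set H := fx G α with hH
  have c1 := card_ob H β
  have c2 := card_ob (fx H β) γ
  have hHβ : fx H β ≠ H := by
    intro h
    rw [h] at hbot
    exact N1 _ hbot
  have hm : 2 ≤ (ob H β).ncard := ob_two hHβ
  have hk := two_le_card (N1 β)
  have hfac : Nat.factorial 2 = 2 := rfl
  rw [hfac] at hdvd htr
  have hcard := arith2 hd hm hk (c1 ▸ hdvd)
  have tr := htr (c1.symm.trans hcard)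
  obtain ⟨g1, hg1, e1⟩ := tr _ hf ![γ, β] ((T _ _).2 (by rw [fx_comm H]; exact hbot))
  have hγ : γ ∈ ob H β := ⟨g1, hg1, e1 0⟩
  rw [hbot, Subgroup.card_bot, mul_one] at c2
  have l1 := ob_lt_card (fx_le H β) (fun g hg => (mem_fx.1 hg).2) hγ hβγ
  rw [c2] at l1
  obtain ⟨hmd, hk2⟩ := arith2' hd hk l1 hcard
  have hdist : ∀ x ∈ ob H β, x ≠ β → fx H β ≠ fx H x := by
    intro x hx hxβ h7
    have h8 := prime_orbit (hmd ▸ hd) hx (fun h => hxβ h.symm) h7 hγ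
    have h9 : fx (fx H β) γ = fx H β := by rw [fx_fx, ← h8, inf_idem]
    rw [h9] at hbot
    exact N1 _ hbot
  have hsub : ob H β \ {β} ⊆ ob (fx H β) γ := by
    rintro x ⟨hx, hxβ⟩
    by_contra hxn
    have hnb : fx (fx H β) x ≠ ⊥ := by
      intro h
      obtain ⟨g, hg, e⟩ := tr _ hf _ ((T _ _).2 h)
      exact hxn ⟨g, mem_fx.2 ⟨hg, e 0⟩, e 1⟩
    rw [fx_fx] at hnb
    exact hdist x hx hxβ (sub_eq (le_of_two hk2 hnb) (by rw [card_fx_eq hx]))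
  have hle := Set.ncard_le_ncard hsub
  rw [Set.ncard_sdiff_singleton_of_mem (self_mem_ob H β), c2, hk2] at hle
  have hm3 : (ob H β).ncard = 3 := by omega
  have hsix : Nat.card H = 6 := by rw [← c1, hm3, hk2]
  have hγ2 : Nat.card (fx H γ) = 2 := by rw [card_fx_eq hγ, hk2]
  have hstabcard : ∀ x, Nat.card (fx G x) = 6 := by
    intro x
    rw [← hsix]
    exact card_fx_eq (htrans α x)
  -- points outside the orbit of length three have the same stabiliser as `α`
  have hout : ∀ x, x ∉ ob H β → fx G x = H := by
    intro x hx
    have hnb : ∀ y ∈ ob H β, fx H y ⊓ fx H x ≠ ⊥ := by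
      intro y hy h
      rw [inf_comm, ← fx_fx] at h
      obtain ⟨g, hg, e⟩ := tr _ hf _ ((T _ _).2 h)
      exact hx ⟨g, hg, e 0⟩
    have h6 := eq_of_six hk2 hγ2 (by rw [← fx_fx]; exact hbot) hsix (fx_le H x)
      (le_of_two hk2 (hnb β (self_mem_ob H β))) (le_of_two hγ2 (hnb γ hγ))
    symm
    apply sub_eq
    · intro g hg
      rw [← h6] at hg
      obtain ⟨h1, h2⟩ := mem_fx.1 hg
      exact mem_fx.2 ⟨(mem_fx.1 h1).1, h2⟩
    · rw [hstabcard, hsix]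
  have hαn : α ∉ ob H β := by
    rintro ⟨g, hg, e⟩
    have h1 := (mem_fx.1 hg).2
    have : β = α := g.injective (e.trans h1.symm)
    exact hαf ⟨0, this⟩
  have hfG : fx G β ≠ H := by
    intro h
    apply hHβ
    apply le_antisymm (fx_le H β)
    intro g hg
    refine mem_fx.2 ⟨hg, ?_⟩
    rw [← h] at hg
    exact (mem_fx.1 hg).2
  have hone : ∀ x, x ∉ ob H β → x = α := by
    intro x hx
    by_contra hxα
    obtain ⟨g, hg, rfl⟩ := htrans α β
    have hgx : fx G (g x) = fx G (g α) := by
      ext h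
      rw [fx_conj hg, fx_conj hg, hout x hx]
    by_cases hin : g x ∈ ob H (g α)
    · refine hdist (g x) hin (fun h => hxα (g.injective h)) ?_
      have e0 : ∀ y, fx H y = H ⊓ fx G y := by
        intro y
        rw [hH, fx_fx]
      rw [e0, e0, hgx]
    · exact hfG (hgx ▸ hout _ hin)
  have huniv : (Set.univ : Set Ω) = insert α (ob H β) := by
    symm
    rw [Set.eq_univ_iff_forall]
    intro x
    by_cases hx : x ∈ ob H β
    · exact Set.mem_insert_of_mem _ hx
    · rw [hone x hx]
      exact Set.mem_insert _ _
  have hΩ : Nat.card Ω = 4 := by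
    rw [← Set.ncard_univ, huniv, Set.ncard_insert_of_notMem hαn, hm3]
  have hobG : ob G α = Set.univ := by
    rw [Set.eq_univ_iff_forall]
    intro x
    exact htrans α x
  refine ⟨by rw [← Nat.card_eq_fintype_card, hΩ], ?_⟩
  apply Subgroup.eq_top_of_card_eq
  rw [← hcG, hobG, Set.ncard_univ, hΩ, hsix, Nat.card_perm, hΩ]
  rfl

end Aux

theorem statement_13 {Ω : Type*} [Fintype Ω] (G : Subgroup (Equiv.Perm Ω))
    (htrans : ∀ α β : Ω, ∃ g ∈ G, g α = β)
    (hb : baseSize G = 3 ∨ baseSize G = 4)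
    -- the common degree of the vertices of `Σ(G)` is a prime `d`
    (d : ℕ) (hd : d.Prime)
    (hdeg : ∀ α : Ω, {E : Set Ω | IsSaxlEdge G E ∧ α ∈ E}.ncard = d) :
    Fintype.card Ω = 4 ∧ G = ⊤ := by
  have hne : Nonempty Ω := by
    by_contra hempty
    rw [not_nonempty_iff] at hempty
    have h0 : baseSize G ≤ (∅ : Set Ω).ncard :=
      Nat.sInf_le ⟨∅, fun g _ _ => Subsingleton.elim _ _, rfl⟩
    rw [Set.ncard_empty] at h0
    omega
  obtain ⟨α⟩ := hne
  rcases hb with hb | hb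
  · exact case3 htrans hb hd (hdeg α)
  · exact (case4 hb hd (hdeg α)).elim
end
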